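/- There exist constants H ≥ 0, L₀ > 0 and 0 ≤ τ < 1 such that for all g ∈ Γ and all ξ, η ∈ ∂Γ with (ξ|η) − |g| ≥ L₀, one has |K(g,ξ)/K(g,η) − 1| ≤ H · τ^{(ξ|η)−|g|}. -/

import Mathlib

open Filter Topology MeasureTheory
open scoped ENNReal

namespace HarmonicBoundary

variable {Γ : Type} [Group Γ]

/-- Word length of `g` with respect to a generating set `S`. -/
noncomputable def wl (S : Set Γ) (g : Γ) : ℕ :=
  sInf {n : ℕ | ∃ w : List Γ, w.length = n ∧ (∀ x ∈ w, x ∈ S) ∧ w.prod = g}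

/-- Word metric `d(x,y) = |x⁻¹y|`. -/
noncomputable def wdist (S : Set Γ) (x y : Γ) : ℕ := wl S (x⁻¹ * y)

/-- Gromov product `(x|y)_z = (d(x,z)+d(y,z)-d(x,y))/2`. -/
noncomputable def gp (S : Set Γ) (z x y : Γ) : ℝ :=
  ((wdist S x z : ℝ) + (wdist S y z : ℝ) - (wdist S x y : ℝ)) / 2

/-- `S` is a finite symmetric generating set of `Γ`. -/
def IsGenSet (S : Set Γ) : Prop :=
  S.Finite ∧ (∀ s ∈ S, s⁻¹ ∈ S) ∧ Subgroup.closure S = ⊤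

/-- `Γ` is `δ`-hyperbolic with respect to the word metric of `S`:
`(x|y) ≥ min ((x|z), (y|z)) - δ` for all `x y z`. -/
def IsHyperbolic (S : Set Γ) (δ : ℝ) : Prop :=
  0 ≤ δ ∧ ∀ x y z : Γ, min (gp S 1 x z) (gp S 1 y z) - δ ≤ gp S 1 x y

/-- `Γ` is nonelementary: it has no cyclic subgroup of finite index. -/
def Nonelementary (Γ : Type) [Group Γ] : Prop :=
  ∀ g : Γ, (Subgroup.zpowers g).index = 0

/-- A sequence converges to infinity if `(x_i|x_j) → ∞`. -/
def ConvInf (S : Set Γ) (u : ℕ → Γ) : Prop :=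
  Tendsto (fun p : ℕ × ℕ => gp S 1 (u p.1) (u p.2)) atTop atTop

/-- Two sequences converging to infinity are equivalent if `(x_i|y_j) → ∞`. -/
def EquivSeq (S : Set Γ) (u v : ℕ → Γ) : Prop :=
  Tendsto (fun p : ℕ × ℕ => gp S 1 (u p.1) (v p.2)) atTop atTop

/-- An (abstract model of the) Gromov boundary of `Γ`: the points are exactly the
classes of sequences converging to infinity, modulo the equivalence `EquivSeq`,
together with the natural left action of `Γ`. -/
structure Boundary (Γ : Type) [Group Γ] (S : Set Γ) where
  pt : Type
  cls : (ℕ → Γ) → pt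
  cls_surj : ∀ ξ : pt, ∃ u : ℕ → Γ, ConvInf S u ∧ cls u = ξ
  cls_eq : ∀ u v : ℕ → Γ, ConvInf S u → ConvInf S v → (cls u = cls v ↔ EquivSeq S u v)
  smul : Γ → pt → pt
  smul_cls : ∀ (g : Γ) (u : ℕ → Γ), ConvInf S u → smul g (cls u) = cls fun n => g * u n

/-- Extension of the Gromov product to the boundary:
`(ξ|η) = sup liminf (x_i|y_j)` over sequences representing `ξ` and `η`,
as an extended nonnegative real. -/
noncomputable def bgp {S : Set Γ} (B : Boundary Γ S) (ξ η : B.pt) : ℝ≥0∞ :=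
  ⨆ (u : {u : ℕ → Γ // ConvInf S u ∧ B.cls u = ξ})
    (v : {v : ℕ → Γ // ConvInf S v ∧ B.cls v = η}),
    Filter.liminf (fun p : ℕ × ℕ => ENNReal.ofReal (gp S 1 (u.1 p.1) (v.1 p.2))) atTop

/-- Real-valued Gromov product on the boundary (finite for `ξ ≠ η`). -/
noncomputable def bgpR {S : Set Γ} (B : Boundary Γ S) (ξ η : B.pt) : ℝ := (bgp B ξ η).toReal

/-- The canonical topology of the Gromov boundary: a set is open iff around each of
its points it contains a basic neighbourhood `V_r(p) = {q | (q|p) > r}`. -/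
def btop {S : Set Γ} (B : Boundary Γ S) : TopologicalSpace B.pt where
  IsOpen O := ∀ p ∈ O, ∃ r : ℝ≥0∞, r ≠ ⊤ ∧ {q | r < bgp B q p} ⊆ O
  isOpen_univ := fun p _ => ⟨0, ENNReal.zero_ne_top, fun q _ => trivial⟩
  isOpen_inter := by
    intro A A' hA hA' p hp
    obtain ⟨r1, hr1, h1⟩ := hA p hp.1
    obtain ⟨r2, hr2, h2⟩ := hA' p hp.2
    refine ⟨max r1 r2, (max_lt hr1.lt_top hr2.lt_top).ne, fun q hq => ?_⟩
    have hq' : max r1 r2 < bgp B q p := hq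
    exact ⟨h1 (show r1 < bgp B q p from (le_max_left r1 r2).trans_lt hq'),
      h2 (show r2 < bgp B q p from (le_max_right r1 r2).trans_lt hq')⟩
  isOpen_sUnion := by
    intro s hs p hp
    obtain ⟨t, ht, hpt⟩ := hp
    obtain ⟨r, hr, hsub⟩ := hs t ht p hpt
    exact ⟨r, hr, fun q hq => ⟨t, ht, hsub hq⟩⟩

/-- The attracting fixed point `g⁺ = lim_n gⁿ` of an (infinite order) element. -/
def plusPt {S : Set Γ} (B : Boundary Γ S) (g : Γ) : B.pt := B.cls fun n => g ^ n

/-- The repelling fixed point `g⁻ = lim_n g⁻ⁿ` of an (infinite order) element. -/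
def minusPt {S : Set Γ} (B : Boundary Γ S) (g : Γ) : B.pt := B.cls fun n => g⁻¹ ^ n

/-- A geodesic ray starting at the identity. -/
def IsGeodesicRay (S : Set Γ) (x : ℕ → Γ) : Prop :=
  x 0 = 1 ∧ ∀ m n : ℕ, wdist S (x m) (x n) = Nat.dist m n

/-- A geodesic ray from `e` to the boundary point `ξ`, i.e. an element of `[e,ξ]`. -/
def RayTo {S : Set Γ} (B : Boundary Γ S) (x : ℕ → Γ) (ξ : B.pt) : Prop :=
  IsGeodesicRay S x ∧ ConvInf S x ∧ B.cls x = ξ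

/-- A geodesic segment from `x` to `y` (parametrized on `0,…,d(x,y)`),
i.e. an element of `[x,y]`. -/
def IsGeodesicSeg (S : Set Γ) (x y : Γ) (α : ℕ → Γ) : Prop :=
  α 0 = x ∧ α (wdist S x y) = y ∧
  ∀ m n : ℕ, m ≤ wdist S x y → n ≤ wdist S x y → wdist S (α m) (α n) = Nat.dist m n

/-- The boundary "cylinder" `U(ξ,R)`: all `η` such that for every pair of geodesic
rays `x ∈ [e,ξ]`, `y ∈ [e,η]` one has `lim_n (x(n)|y(n)) > R` (the sequence
`(x(n)|y(n))` is nondecreasing, so the limit exceeds `R` iff some term does). -/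
def Uset {S : Set Γ} (B : Boundary Γ S) (ξ : B.pt) (R : ℝ) : Set B.pt :=
  {η | ∀ x y : ℕ → Γ, RayTo B x ξ → RayTo B y η → ∃ n : ℕ, R < gp S 1 (x n) (y n)}

/-- `C_r(p) = {g | (g|e)_p > r}`. -/
def Cset (S : Set Γ) (p : Γ) (r : ℝ) : Set Γ := {g | r < gp S p g 1}

/-- The `R`-neighbourhood `N(α,R)` of a geodesic segment `α ∈ [x,y]`. -/
def segN (S : Set Γ) (x y : Γ) (α : ℕ → Γ) (R : ℝ) : Set Γ :=
  {g | ∃ i ≤ wdist S x y, (wdist S g (α i) : ℝ) ≤ R}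

/-- The `R`-neighbourhood `N(A,R)` of a subset `A ⊆ Γ`. -/
def setN (S : Set Γ) (A : Set Γ) (R : ℝ) : Set Γ :=
  {g | ∃ a ∈ A, (wdist S g a : ℝ) ≤ R}

/-- `μ` is a nondegenerate probability measure on `Γ` with support contained in `S`:
nonnegative, of total mass one, supported in `S`, and the semigroup generated by its
support is the whole of `Γ`. -/
structure IsRWMeasure (S : Set Γ) (μ : Γ → ℝ) : Prop where
  nonneg : ∀ g, 0 ≤ μ g
  support_subset : ∀ g, μ g ≠ 0 → g ∈ S
  total : ∑' g : Γ, μ g = 1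
  nondeg : ∀ g : Γ, ∃ l : List Γ, l ≠ [] ∧ (∀ x ∈ l, 0 < μ x) ∧ l.prod = g

open Classical in
/-- `n`-step transition probabilities `p⁽ⁿ⁾(x,y) = μ*ⁿ(x⁻¹y)` of the random walk. -/
noncomputable def ptrans (μ : Γ → ℝ) : ℕ → Γ → Γ → ℝ
  | 0 => fun x y => if x = y then 1 else 0
  | n + 1 => fun x y => ∑' z : Γ, ptrans μ n x z * μ (z⁻¹ * y)

/-- Green function `G(x,y) = Σ_n p⁽ⁿ⁾(x,y)`. -/
noncomputable def green (μ : Γ → ℝ) (x y : Γ) : ℝ := ∑' n : ℕ, ptrans μ n x y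

/-- `F(x,y) = G(x,y)/G(y,y)`, the probability that the walk from `x` ever hits `y`. -/
noncomputable def greenF (μ : Γ → ℝ) (x y : Γ) : ℝ := green μ x y / green μ y y

/-- The Martin kernel `K(x,y) = G(x,y)/G(e,y)`. -/
noncomputable def martinK (μ : Γ → ℝ) (x y : Γ) : ℝ := green μ x y / green μ 1 y

open Classical in
/-- Transition probabilities of the walk restricted to `Δ` (killed when leaving `Δ`). -/
noncomputable def ptransR (μ : Γ → ℝ) (Δ : Set Γ) : ℕ → Γ → Γ → ℝ
  | 0 => fun x y => if x = y ∧ x ∈ Δ then 1 else 0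
  | n + 1 => fun x y => if y ∈ Δ then ∑' z : Γ, ptransR μ Δ n x z * μ (z⁻¹ * y) else 0

/-- Green function `G_Δ` of the restricted walk. -/
noncomputable def greenR (μ : Γ → ℝ) (Δ : Set Γ) (x y : Γ) : ℝ := ∑' n : ℕ, ptransR μ Δ n x y

/-- `F_Δ(x,y) = G_Δ(x,y)/G_Δ(y,y)`. -/
noncomputable def greenFR (μ : Γ → ℝ) (Δ : Set Γ) (x y : Γ) : ℝ :=
  greenR μ Δ x y / greenR μ Δ y y

/-- Generating function `G_Δ(x,y|z) = Σ_n p_Δ⁽ⁿ⁾(x,y) zⁿ`. -/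
noncomputable def greenRZ (μ : Γ → ℝ) (Δ : Set Γ) (x y : Γ) (z : ℝ) : ℝ :=
  ∑' n : ℕ, ptransR μ Δ n x y * z ^ n

/-- Spectral radius `ρ(P) = lim_n p⁽ⁿ⁾(e,e)^{1/n}` of the walk. -/
noncomputable def specRad (μ : Γ → ℝ) : ℝ :=
  Filter.limsup (fun n : ℕ => (ptrans μ n 1 1) ^ ((n : ℝ)⁻¹)) atTop

/-- `u` is harmonic on `Λ`: `Σ_h p(g,h) u(h) = u(g)` for `g ∈ Λ`, `p(g,h)=μ(g⁻¹h)`. -/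
def HarmonicOn (μ : Γ → ℝ) (u : Γ → ℝ) (Λ : Set Γ) : Prop :=
  ∀ g ∈ Λ, (∑' h : Γ, μ (g⁻¹ * h) * u h) = u g

/-- `u` vanishes at infinity on `Λ`: `u(g_n) → 0` along sequences in `Λ` with `|g_n|→∞`. -/
def VanishesAtInftyOn (S : Set Γ) (u : Γ → ℝ) (Λ : Set Γ) : Prop :=
  ∀ ε : ℝ, 0 < ε → ∃ M : ℕ, ∀ g ∈ Λ, M ≤ wl S g → |u g| ≤ ε

open Classical in
/-- `r(g) = K(g⁻¹,g⁺)` for infinite order `g`, and `r(g) = 1` for finite order `g`;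
here `Kb` is the boundary extension of the Martin kernel. -/
noncomputable def rfun {S : Set Γ} (B : Boundary Γ S) (Kb : Γ → B.pt → ℝ) (g : Γ) : ℝ :=
  if IsOfFinOrder g then 1 else Kb g⁻¹ (plusPt B g)

/-- The ratio set `r(Γ,∂Γ,ν)`: all `l ≥ 0` such that for every `ε > 0` and every
Borel `A` of positive measure there is `g ∈ Γ` such that
`{ω ∈ gA ∩ A : |d(gν)/dν(ω) − l| < ε}` has positive measure; here the
Radon–Nikodym derivative `d(gν)/dν` is the Martin kernel `Kb g`. -/
def ratioSet {S : Set Γ} (B : Boundary Γ S) [MeasurableSpace B.pt]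
    (ν : Measure B.pt) (Kb : Γ → B.pt → ℝ) : Set ℝ :=
  {l : ℝ | 0 ≤ l ∧ ∀ ε : ℝ, 0 < ε → ∀ A : Set B.pt, MeasurableSet A → 0 < ν A →
    ∃ g : Γ, 0 < ν {ω | ω ∈ A ∧ B.smul g⁻¹ ω ∈ A ∧ |Kb g ω - l| < ε}}

/-- A left invariant finitely additive mean on `Γ`; `Γ` is amenable iff one exists. -/
structure InvariantMean (Γ : Type) [Group Γ] where
  m : Set Γ → ℝ
  nonneg : ∀ A, 0 ≤ m A
  total : m Set.univ = 1
  fin_add : ∀ A B : Set Γ, Disjoint A B → m (A ∪ B) = m A + m B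
  invariant : ∀ (g : Γ) (A : Set Γ), m ((g * ·) ⁻¹' A) = m A

/-! ### The word metric -/

lemma wl_le_of_list (S : Set Γ) (w : List Γ) (hw : ∀ x ∈ w, x ∈ S) : wl S w.prod ≤ w.length :=
  Nat.sInf_le ⟨w, rfl, hw, rfl⟩

lemma exists_word {S : Set Γ} (hS : IsGenSet S) (g : Γ) :
    ∃ w : List Γ, (∀ x ∈ w, x ∈ S) ∧ w.prod = g := by
  have hg : g ∈ Subgroup.closure S := by rw [hS.2.2]; trivial
  induction hg using Subgroup.closure_induction with
  | mem x hx => exact ⟨[x], by simpa using hx, by simp⟩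
  | one => exact ⟨[], by simp, rfl⟩
  | mul x y _ _ hx hy =>
    obtain ⟨a, ha, ha'⟩ := hx
    obtain ⟨b, hb, hb'⟩ := hy
    refine ⟨a ++ b, ?_, by simp [ha', hb']⟩
    intro z hz
    rcases List.mem_append.1 hz with h | h
    · exact ha z h
    · exact hb z h
  | inv x _ hx =>
    obtain ⟨a, ha, ha'⟩ := hx
    refine ⟨(a.map (·⁻¹)).reverse, ?_, ?_⟩
    · intro z hz
      simp only [List.mem_reverse, List.mem_map] at hz
      obtain ⟨y, hy, rfl⟩ := hz
      exact hS.2.1 y (ha y hy)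
    · rw [← ha', List.prod_inv_reverse]

lemma wl_spec {S : Set Γ} (hS : IsGenSet S) (g : Γ) :
    ∃ w : List Γ, w.length = wl S g ∧ (∀ x ∈ w, x ∈ S) ∧ w.prod = g := by
  have : {n : ℕ | ∃ w : List Γ, w.length = n ∧ (∀ x ∈ w, x ∈ S) ∧ w.prod = g}.Nonempty := by
    obtain ⟨w, h1, h2⟩ := exists_word hS g
    exact ⟨w.length, w, rfl, h1, h2⟩
  exact Nat.sInf_mem this

lemma wl_one (S : Set Γ) : wl S (1 : Γ) = 0 := by
  have := wl_le_of_list S [] (by simp)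
  simpa using this

lemma wl_mul {S : Set Γ} (hS : IsGenSet S) (g h : Γ) : wl S (g * h) ≤ wl S g + wl S h := by
  obtain ⟨a, ha, ha1, rfl⟩ := wl_spec hS g
  obtain ⟨b, hb, hb1, rfl⟩ := wl_spec hS h
  rw [← ha, ← hb, ← List.prod_append, ← List.length_append]
  apply wl_le_of_list
  intro z hz
  rcases List.mem_append.1 hz with h | h
  · exact ha1 z h
  · exact hb1 z h

lemma wl_inv_le {S : Set Γ} (hS : IsGenSet S) (g : Γ) : wl S g⁻¹ ≤ wl S g := by
  obtain ⟨a, ha, ha1, rfl⟩ := wl_spec hS g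
  have := wl_le_of_list S (a.map (·⁻¹)).reverse (by
    intro z hz
    simp only [List.mem_reverse, List.mem_map] at hz
    obtain ⟨y, hy, rfl⟩ := hz
    exact hS.2.1 y (ha1 y hy))
  rw [← List.prod_inv_reverse] at this
  simpa [ha] using this

lemma wl_inv {S : Set Γ} (hS : IsGenSet S) (g : Γ) : wl S g⁻¹ = wl S g := by
  apply le_antisymm (wl_inv_le hS g)
  simpa using wl_inv_le hS g⁻¹

lemma wl_eq_zero {S : Set Γ} (hS : IsGenSet S) {g : Γ} (h : wl S g = 0) : g = 1 := by
  obtain ⟨a, ha, ha1, rfl⟩ := wl_spec hS g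
  rw [h] at ha
  simp [List.length_eq_zero_iff.1 ha]

lemma wl_gen {S : Set Γ} {s : Γ} (hs : s ∈ S) : wl S s ≤ 1 := by
  simpa using wl_le_of_list S [s] (by simpa using hs)

/-- Splitting a group element along a geodesic. -/
lemma wl_split {S : Set Γ} (hS : IsGenSet S) (g : Γ) (n : ℕ) (hn : n ≤ wl S g) :
    ∃ p : Γ, wl S p = n ∧ wl S (p⁻¹ * g) = wl S g - n := by
  obtain ⟨a, ha, ha1, hp⟩ := wl_spec hS g
  have e : (a.take n).prod * (a.drop n).prod = g := by rw [← List.prod_append, List.take_append_drop, hp]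
  have e2 : (a.take n).prod⁻¹ * g = (a.drop n).prod := by rw [← e]; group
  have h1 := wl_le_of_list S (a.take n) (fun x hx => ha1 x (List.mem_of_mem_take hx))
  have h2 := wl_le_of_list S (a.drop n) (fun x hx => ha1 x (List.mem_of_mem_drop hx))
  have h3 := wl_mul hS (a.take n).prod (a.drop n).prod
  rw [e] at h3
  simp only [List.length_take, List.length_drop] at h1 h2
  refine ⟨(a.take n).prod, ?_, ?_⟩
  · omega
  · rw [e2]; omega

lemma wl_split_gen {S : Set Γ} (hS : IsGenSet S) (g : Γ) (hn : wl S g ≠ 0) :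
    ∃ s ∈ S, wl S (s⁻¹ * g) = wl S g - 1 := by
  obtain ⟨a, ha, ha1, hp⟩ := wl_spec hS g
  cases a with
  | nil => simp at ha; omega
  | cons s l =>
    refine ⟨s, ha1 s (by simp), ?_⟩
    have h2 := wl_le_of_list S l (fun x hx => ha1 x (by simp [hx]))
    have e : s⁻¹ * g = l.prod := by rw [← hp]; simp
    have h3 := wl_mul hS s (s⁻¹ * g)
    have h4 := wl_gen (ha1 s (by simp))
    rw [mul_inv_cancel_left] at h3
    simp only [List.length_cons] at ha
    rw [e] at h3 ⊢
    omega

lemma ball_finite {S : Set Γ} (hS : IsGenSet S) (n : ℕ) : {g : Γ | wl S g ≤ n}.Finite := by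
  induction n with
  | zero =>
    apply (Set.finite_singleton (1 : Γ)).subset
    intro g hg
    exact wl_eq_zero hS (Nat.le_zero.1 hg)
  | succ n ih =>
    apply ((Set.finite_singleton (1 : Γ)).union (Set.Finite.mul hS.1 ih)).subset
    intro g hg
    by_cases h0 : wl S g = 0
    · left; exact wl_eq_zero hS h0
    · right
      obtain ⟨s, hs, h⟩ := wl_split_gen hS g h0
      refine ⟨s, hs, s⁻¹ * g, ?_, by simp⟩
      have hg' : wl S g ≤ n + 1 := hg
      show wl S _ ≤ n
      omega

/-- Real valued word metric. -/
noncomputable def dd (S : Set Γ) (x y : Γ) : ℝ := (wdist S x y : ℝ)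

lemma dd_one (S : Set Γ) (x : Γ) : dd S 1 x = wl S x := by simp [dd, wdist]

lemma dd_self (S : Set Γ) (x : Γ) : dd S x x = 0 := by simp [dd, wdist, wl_one]

lemma dd_nonneg (S : Set Γ) (x y : Γ) : 0 ≤ dd S x y := by simp [dd]

lemma dd_comm {S : Set Γ} (hS : IsGenSet S) (x y : Γ) : dd S x y = dd S y x := by
  unfold dd wdist
  rw [← wl_inv hS (x⁻¹ * y)]
  simp

lemma dd_tri {S : Set Γ} (hS : IsGenSet S) (x y z : Γ) : dd S x z ≤ dd S x y + dd S y z := by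
  unfold dd wdist
  have := wl_mul hS (x⁻¹ * y) (y⁻¹ * z)
  rw [show x⁻¹ * y * (y⁻¹ * z) = x⁻¹ * z by group] at this
  exact_mod_cast this

lemma dd_mul (S : Set Γ) (g x y : Γ) : dd S (g * x) (g * y) = dd S x y := by
  unfold dd wdist
  rw [show (g * x)⁻¹ * (g * y) = x⁻¹ * y by group]

lemma dd_right (S : Set Γ) (x g : Γ) : dd S x (x * g) = wl S g := by
  simp [dd, wdist]

lemma gp_eq (S : Set Γ) (z x y : Γ) : gp S z x y = (dd S x z + dd S y z - dd S x y) / 2 := rfl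

/-- Four point inequality. -/
lemma four_pt {S : Set Γ} {δ : ℝ} (hS : IsGenSet S) (hδ : IsHyperbolic S δ) (o x y z : Γ) :
    dd S x y + dd S z o ≤ dd S x z + dd S y o + 2 * δ ∨
    dd S x y + dd S z o ≤ dd S y z + dd S x o + 2 * δ := by
  have h := hδ.2 (o⁻¹ * x) (o⁻¹ * y) (o⁻¹ * z)
  have e : (1 : Γ) = o⁻¹ * o := by simp
  rw [gp_eq, gp_eq, gp_eq, e] at h
  simp only [dd_mul] at h
  rcases min_choice ((dd S x o + dd S z o - dd S x z) / 2) ((dd S y o + dd S z o - dd S y z) / 2)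
    with h1 | h1 <;> rw [h1] at h
  · left
    linarith
  · right
    linarith

lemma dd_eq_zero {S : Set Γ} (hS : IsGenSet S) {x y : Γ} (h : dd S x y = 0) : x = y := by
  unfold dd wdist at h
  have := wl_eq_zero hS (g := x⁻¹ * y) (by exact_mod_cast h)
  exact (inv_mul_eq_one.1 this)

/-- Points on geodesics. -/
lemma dd_split {S : Set Γ} (hS : IsGenSet S) (x y : Γ) (n : ℕ) (hn : (n : ℝ) ≤ dd S x y) :
    ∃ p : Γ, dd S x p = n ∧ dd S p y = dd S x y - n := by
  have hn' : n ≤ wl S (x⁻¹ * y) := by unfold dd wdist at hn; exact_mod_cast hn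
  obtain ⟨p, hp, hp2⟩ := wl_split hS (x⁻¹ * y) n hn'
  refine ⟨x * p, by rw [dd_right, hp], ?_⟩
  unfold dd wdist
  rw [show (x * p)⁻¹ * y = p⁻¹ * (x⁻¹ * y) by group, hp2, Nat.cast_sub hn']

lemma gp_hyp {S : Set Γ} {δ : ℝ} (hS : IsGenSet S) (hδ : IsHyperbolic S δ) (o x y z : Γ) :
    gp S o x z ≤ gp S o x y + δ ∨ gp S o y z ≤ gp S o x y + δ := by
  rcases four_pt hS hδ o x y z with h | h
  · left
    rw [gp_eq, gp_eq]; linarith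
  · right
    rw [gp_eq, gp_eq]; linarith

/-! ### Loxodromic elements and tripods -/

lemma dd_pow (S : Set Γ) (g : Γ) (i m : ℕ) : dd S (g ^ i) (g ^ (i + m)) = wl S (g ^ m) := by
  rw [pow_add, dd_right]

lemma dd_pow' {S : Set Γ} (hS : IsGenSet S) (g : Γ) (i m : ℕ) :
    dd S (g ^ (i + m)) (g ^ i) = wl S (g ^ m) := by
  rw [dd_comm hS, dd_pow]

lemma dd_one' {S : Set Γ} (hS : IsGenSet S) (x : Γ) : dd S x 1 = wl S x := by
  rw [dd_comm hS, dd_one]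

lemma lox_step {S : Set Γ} {δ : ℝ} (hS : IsGenSet S) (hδ : IsHyperbolic S δ) (g : Γ) (a : ℝ)
    (ha : 0 ≤ a) (h2 : 2 * (wl S g : ℝ) - 2 * a ≤ wl S (g ^ 2))
    (hg : 2 * a + 2 * δ < wl S g) (i : ℕ) :
    (wl S (g ^ i) : ℝ) + wl S g - 2 * (a + δ) ≤ wl S (g ^ (i + 1)) := by
  induction i with
  | zero => simp [wl_one]; linarith [hδ.1]
  | succ i ih =>
    have h := four_pt hS hδ (g ^ (i + 1)) (g ^ i) (g ^ (i + 2)) 1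
    have e1 := dd_pow S g i 2
    have e2 := dd_pow S g i 1
    have e3 := dd_pow' hS g (i + 1) 1
    rw [show i + 1 + 1 = i + 2 from rfl] at e3
    rw [show i + 1 + 1 = i + 2 from rfl]
    rw [dd_one, dd_one' hS, dd_one' hS, e1, e2, e3, pow_one] at h
    rcases h with h | h <;> linarith

lemma lox_add {S : Set Γ} {δ : ℝ} (hS : IsGenSet S) (hδ : IsHyperbolic S δ) (g : Γ) (a : ℝ)
    (ha : 0 ≤ a) (h2 : 2 * (wl S g : ℝ) - 2 * a ≤ wl S (g ^ 2))
    (hg : 2 * a + 3 * δ < wl S g) (j m : ℕ) :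
    (wl S (g ^ j) : ℝ) + wl S (g ^ m) - 2 * (a + 2 * δ) ≤ wl S (g ^ (j + m)) := by
  have hδ0 := hδ.1
  cases j with
  | zero => simp [wl_one]; linarith
  | succ i =>
    have h := four_pt hS hδ (g ^ (i + 1)) (g ^ i) (g ^ (i + 1 + m)) 1
    have e1 := dd_pow S g i (1 + m)
    rw [← add_assoc] at e1
    have e2 := dd_pow S g i 1
    have e3 := dd_pow' hS g (i + 1) m
    rw [dd_one, dd_one' hS, dd_one' hS, e1, e2, e3, pow_one] at h
    have s1 := lox_step hS hδ g a ha h2 (by linarith) i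
    have s2 := lox_step hS hδ g a ha h2 (by linarith) m
    rw [add_comm m 1] at s2
    rcases h with h | h <;> linarith

lemma infinite_of_nonelem (hne : Nonelementary Γ) : Infinite Γ := by
  have h := hne 1
  rw [Subgroup.zpowers_one_eq_bot, Subgroup.index_bot] at h
  by_contra hf
  rw [not_infinite_iff_finite] at hf
  exact Nat.card_pos.ne' h

lemma exists_large {S : Set Γ} (hS : IsGenSet S) [Infinite Γ] (n : ℕ) : ∃ g : Γ, n ≤ wl S g := by
  by_contra hc
  push Not at hc
  exact Set.infinite_univ ((ball_finite hS n).subset fun g _ => (hc g).le)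

lemma exists_lox {S : Set Γ} {δ : ℝ} (hS : IsGenSet S) (hδ : IsHyperbolic S δ) [Infinite Γ] :
    ∃ g : Γ, 2 * (wl S g : ℝ) - 2 * (3 * δ) ≤ wl S (g ^ 2) ∧ 2 * (3 * δ) + 3 * δ + 1 < wl S g := by
  have hδ0 := hδ.1
  obtain ⟨n, hn⟩ := exists_nat_gt (10 * δ + 2)
  obtain ⟨c0, hc0⟩ := exists_large hS (2 * n)
  obtain ⟨c, hc, -⟩ := wl_split hS c0 (2 * n) hc0
  obtain ⟨p, hp, hp2⟩ := wl_split hS c n (by omega)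
  have hb : wl S (p⁻¹ * c) = n := by omega
  set a := p⁻¹ with ha
  set b := p⁻¹ * c with hbd
  have hal : wl S a = n := by rw [ha, wl_inv hS, hp]
  have hab : dd S a b = 2 * n := by
    rw [hbd, ha, dd_right, hc]; push_cast; ring
  -- products
  have ha1 : dd S a 1 = n := by rw [dd_one' hS, hal]
  have hb1 : dd S b 1 = n := by rw [dd_one' hS, hb]
  have hai1 : dd S a⁻¹ 1 = n := by rw [dd_one' hS, wl_inv hS, hal]
  have hbi1 : dd S b⁻¹ 1 = n := by rw [dd_one' hS, wl_inv hS, hb]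
  have key : ∀ x : Γ, dd S x x⁻¹ = wl S (x ^ 2) := by
    intro x
    rw [dd_comm hS]; simp [dd, wdist, pow_two]
  by_cases hA : gp S 1 a a⁻¹ ≤ δ
  · refine ⟨a, ?_, ?_⟩
    · rw [gp_eq, key, ha1, hai1] at hA
      rw [hal]; linarith
    · rw [hal]; linarith
  by_cases hB : gp S 1 b b⁻¹ ≤ δ
  · refine ⟨b, ?_, ?_⟩
    · rw [gp_eq, key, hb1, hbi1] at hB
      rw [hb]; linarith
    · rw [hb]; linarith
  have h0 : gp S 1 a b = 0 := by rw [gp_eq, ha1, hb1, hab]; ring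
  have h1 : gp S 1 b a⁻¹ ≤ δ := by
    rcases gp_hyp hS hδ 1 a b a⁻¹ with h | h <;> linarith
  have h2 : gp S 1 a b⁻¹ ≤ δ := by
    rcases gp_hyp hS hδ 1 a b b⁻¹ with h | h <;> linarith
  have hg : 2 * (n : ℝ) - 2 * δ ≤ wl S (a * b) := by
    rw [gp_eq, hb1, hai1, dd_comm hS] at h1
    have : dd S a⁻¹ b = wl S (a * b) := by simp [dd, wdist]
    linarith
  have g1 : dd S (a * b) 1 = wl S (a * b) := dd_one' hS _
  have gi1 : dd S (a * b)⁻¹ 1 = wl S (a * b) := by rw [dd_one' hS, wl_inv hS]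
  have h3 : n - δ ≤ gp S 1 a (a * b) := by
    rw [gp_eq, ha1, g1, dd_right, hb]; linarith
  have h4 : n - δ ≤ gp S 1 (a * b)⁻¹ b⁻¹ := by
    have : dd S (a * b)⁻¹ b⁻¹ = n := by
      unfold dd wdist
      rw [show (a * b)⁻¹⁻¹ * b⁻¹ = a by group, hal]
    rw [gp_eq, gi1, hbi1, this]; linarith
  have h5 : gp S 1 (a * b) (a * b)⁻¹ ≤ 3 * δ := by
    have hs : ∀ x y : Γ, gp S 1 x y = gp S 1 y x := by
      intro x y
      rw [gp_eq, gp_eq, dd_comm hS x y]; ring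
    rcases gp_hyp hS hδ 1 a b⁻¹ (a * b) with h | h
    · linarith
    · have e1 := hs b⁻¹ (a * b)
      have e2 := hs b⁻¹ (a * b)⁻¹
      rcases gp_hyp hS hδ 1 (a * b) b⁻¹ (a * b)⁻¹ with h' | h' <;> linarith
  refine ⟨a * b, ?_, by linarith⟩
  rw [gp_eq, key, g1, gi1] at h5
  linarith

lemma lox_proj {S : Set Γ} {δ κ : ℝ} (hS : IsGenSet S) (hδ : IsHyperbolic S δ) (g h : Γ)
    (hκ : 0 ≤ κ)
    (hg : ∀ j m : ℕ, (wl S (g ^ j) : ℝ) + wl S (g ^ m) - 2 * κ ≤ wl S (g ^ (j + m)))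
    (hh : ∀ j : ℕ, (wl S h : ℝ) ≤ dd S (g ^ j) h) (N : ℕ) :
    gp S 1 h (g ^ N) ≤ wl S g + 2 * κ + 2 * δ := by
  have hδ0 := hδ.1
  set t := gp S 1 h (g ^ N) with ht
  have htN : t ≤ wl S (g ^ N) := by
    have := dd_tri hS h (g ^ N) 1
    rw [dd_one' hS, dd_one' hS] at this
    rw [ht, gp_eq, dd_one' hS, dd_one' hS]; linarith
  have hex : ∃ j : ℕ, t ≤ wl S (g ^ j) := ⟨N, htN⟩
  classical
  obtain ⟨j, hj, hmin⟩ : ∃ j : ℕ, t ≤ wl S (g ^ j) ∧ ∀ i < j, (wl S (g ^ i) : ℝ) < t :=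
    ⟨Nat.find hex, Nat.find_spec hex, fun i hi => not_le.1 (Nat.find_min hex hi)⟩
  have hjN : j ≤ N := by
    by_contra hc
    exact absurd (hmin N (not_le.1 hc)) (not_lt.2 htN)
  rcases Nat.eq_zero_or_pos j with h0 | h0
  · rw [h0] at hj
    simp [wl_one] at hj
    have : (0 : ℝ) ≤ wl S g := by positivity
    linarith
  obtain ⟨i, rfl⟩ : ∃ i, j = i + 1 := ⟨j - 1, by omega⟩
  have h1 := hmin i (by omega)
  have h2 : (wl S (g ^ (i + 1)) : ℝ) ≤ wl S (g ^ i) + wl S g := by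
    rw [pow_succ]; exact_mod_cast wl_mul hS _ _
  obtain ⟨m, rfl⟩ := Nat.exists_eq_add_of_le hjN
  have h3 := hg (i + 1) m
  have h4 := hh (i + 1)
  have e1 := dd_pow S g (i + 1) m
  rcases gp_hyp hS hδ 1 h (g ^ (i + 1)) (g ^ (i + 1 + m)) with h5 | h5
  · rw [← ht, gp_eq, dd_one' hS, dd_one' hS, dd_comm hS] at h5
    linarith
  · rw [gp_eq, gp_eq, dd_one' hS, dd_one' hS, dd_one' hS, e1, dd_comm hS h] at h5
    linarith

lemma exists_far {S : Set Γ} (hS : IsGenSet S) (hne : Nonelementary Γ) (g : Γ) (n : ℕ) :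
    ∃ h : Γ, ∀ j : ℤ, n ≤ wdist S (g ^ j) h := by
  by_contra hc
  push Not at hc
  apply (Subgroup.zpowers g).index_ne_zero_of_finite (hH := ?_) (hne g)
  have hfin : Finite ({x : Γ | wl S x ≤ n}) := ball_finite hS n
  refine Finite.of_surjective (fun x : {x : Γ | wl S x ≤ n} => (QuotientGroup.mk (x.1⁻¹) : Γ ⧸ Subgroup.zpowers g)) ?_
  intro q
  obtain ⟨y, rfl⟩ := QuotientGroup.mk_surjective q
  obtain ⟨j, hj⟩ := hc y⁻¹
  refine ⟨⟨(g ^ j)⁻¹ * y⁻¹, hj.le⟩, ?_⟩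
  rw [QuotientGroup.eq]
  refine ⟨-j, ?_⟩
  simp

lemma exists_far' {S : Set Γ} (hS : IsGenSet S) (hne : Nonelementary Γ) (g : Γ) (n : ℕ) :
    ∃ h : Γ, n ≤ wl S h ∧ ∀ j : ℤ, (wl S h : ℝ) ≤ dd S (g ^ j) h := by
  obtain ⟨h, hh⟩ := exists_far hS hne g n
  obtain ⟨j, hj⟩ : ∃ j : ℤ, ∀ i : ℤ, wdist S (g ^ j) h ≤ wdist S (g ^ i) h := by
    have := Function.argmin_le (fun j : ℤ => wdist S (g ^ j) h)
    exact ⟨_, fun i => this i⟩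
  have e : wl S (g ^ (-j) * h) = wdist S (g ^ j) h := by simp [wdist]
  refine ⟨g ^ (-j) * h, by rw [e]; exact hh j, fun i => ?_⟩
  have e2 : dd S (g ^ i) (g ^ (-j) * h) = dd S (g ^ (j + i)) h := by
    rw [← dd_mul S (g ^ j), ← zpow_add, ← mul_assoc, ← zpow_add]; simp
  rw [e2, e]
  unfold dd
  exact_mod_cast hj _

lemma gp_trunc {S : Set Γ} (hS : IsGenSet S) (a b a' : Γ)
    (ha : dd S a' a = dd S 1 a - dd S 1 a') : gp S 1 a' b ≤ gp S 1 a b := by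
  rw [gp_eq, gp_eq]
  have := dd_tri hS a a' b
  rw [dd_comm hS a a'] at this
  rw [dd_comm hS a' 1, dd_comm hS a 1]
  linarith

lemma gp_comm {S : Set Γ} (hS : IsGenSet S) (o x y : Γ) : gp S o x y = gp S o y x := by
  rw [gp_eq, gp_eq, dd_comm hS x y]; ring

/-- Tripods with arbitrarily long legs exist in nonelementary hyperbolic groups. -/
lemma exists_tripod {S : Set Γ} {δ : ℝ} (hS : IsGenSet S) (hδ : IsHyperbolic S δ)
    (hne : Nonelementary Γ) :
    ∃ k : ℝ, 0 ≤ k ∧ ∀ n : ℕ, ∃ a : Fin 3 → Γ, (∀ i, wl S (a i) = n) ∧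
      ∀ i j, i ≠ j → gp S 1 (a i) (a j) ≤ k := by
  have hδ0 := hδ.1
  have := infinite_of_nonelem hne
  obtain ⟨g, hg1, hg2⟩ := exists_lox hS hδ
  have hadd := lox_add hS hδ g (3 * δ) (by linarith) hg1 (by linarith)
  have hstep := lox_step hS hδ g (3 * δ) (by linarith) hg1 (by linarith)
  have hadd' : ∀ j m : ℕ, (wl S (g⁻¹ ^ j) : ℝ) + wl S (g⁻¹ ^ m) - 2 * (3 * δ + 2 * δ) ≤
      wl S (g⁻¹ ^ (j + m)) := by
    intro j m
    simp only [inv_pow, wl_inv hS]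
    exact hadd j m
  have hlen : ∀ n : ℕ, (n : ℝ) ≤ wl S (g ^ n) := by
    intro n
    induction n with
    | zero => simp
    | succ n ih => have := hstep n; push_cast; linarith
  refine ⟨wl S g + 2 * (3 * δ + 2 * δ) + 2 * δ, by positivity, fun n => ?_⟩
  obtain ⟨h, hh1, hh2⟩ := exists_far' hS hne g n
  have p1 : gp S 1 h (g ^ n) ≤ _ := lox_proj hS hδ g h (by linarith) hadd (fun j => by
    simpa using hh2 j) n
  have p2 : gp S 1 h (g⁻¹ ^ n) ≤ _ := lox_proj hS hδ g⁻¹ h (by linarith) hadd' (fun j => by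
    simpa using hh2 (-j)) n
  rw [wl_inv hS] at p2
  have p3 : gp S 1 (g ^ n) (g⁻¹ ^ n) ≤ wl S g + 2 * (3 * δ + 2 * δ) + 2 * δ := by
    have e : dd S (g ^ n) (g⁻¹ ^ n) = wl S (g ^ (n + n)) := by
      rw [dd_comm hS]; simp [dd, wdist, pow_add]
    rw [gp_eq, dd_one' hS, dd_one' hS, e, inv_pow, wl_inv hS]
    have := hadd n n
    have : (0 : ℝ) ≤ wl S g := by positivity
    linarith
  have hb : ∀ i : Fin 3, n ≤ wl S ((![h, g ^ n, g⁻¹ ^ n] : Fin 3 → Γ) i) := by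
    intro i
    fin_cases i
    · exact hh1
    · simp; exact_mod_cast hlen n
    · simp [wl_inv hS]; exact_mod_cast hlen n
  have hsp : ∀ i : Fin 3, ∃ p : Γ, wl S p = n ∧
      dd S p ((![h, g ^ n, g⁻¹ ^ n] : Fin 3 → Γ) i) =
      dd S 1 ((![h, g ^ n, g⁻¹ ^ n] : Fin 3 → Γ) i) - dd S 1 p := by
    intro i
    obtain ⟨p, h1, h2⟩ := dd_split hS 1 _ n (by rw [dd_one]; exact_mod_cast hb i)
    exact ⟨p, by rw [dd_one] at h1; exact_mod_cast h1, by rw [h2, h1]⟩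
  choose a ha1 ha2 using hsp
  refine ⟨a, ha1, fun i j hij => ?_⟩
  refine (gp_trunc hS _ (a j) _ (ha2 i)).trans ?_
  rw [gp_comm hS]
  refine (gp_trunc hS _ _ _ (ha2 j)).trans ?_
  fin_cases i <;> fin_cases j <;> simp at hij ⊢
  all_goals try (simp only [inv_pow] at p1 p2 p3)
  all_goals first
    | exact p1
    | exact p2
    | exact p3
    | (rw [gp_comm hS]; first | exact p1 | exact p2 | exact p3)

/-! ### Nonnegative kernels -/

/-- Kernels with values in `[0,∞]`. -/
def Ker (X : Type) : Type := X → X → ℝ≥0∞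

namespace Ker
variable {X : Type}

instance : PartialOrder (Ker X) := inferInstanceAs (PartialOrder (X → X → ℝ≥0∞))

lemma le_def {p q : Ker X} : p ≤ q ↔ ∀ x y, p x y ≤ q x y := Iff.rfl

@[ext] lemma ext {p q : Ker X} (h : ∀ x y, p x y = q x y) : p = q := funext fun x => funext (h x)

instance : Add (Ker X) := ⟨fun p q x y => p x y + q x y⟩
instance : Zero (Ker X) := ⟨fun _ _ => 0⟩
noncomputable instance : Mul (Ker X) := ⟨fun p q x y => ∑' z, p x z * q z y⟩
open Classical in
noncomputable instance : One (Ker X) := ⟨fun x y => if x = y then 1 else 0⟩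

lemma add_apply (p q : Ker X) (x y : X) : (p + q) x y = p x y + q x y := rfl
lemma zero_apply (x y : X) : (0 : Ker X) x y = 0 := rfl
lemma mul_apply (p q : Ker X) (x y : X) : (p * q) x y = ∑' z, p x z * q z y := rfl
open Classical in
lemma one_apply (x y : X) : (1 : Ker X) x y = if x = y then 1 else 0 := rfl
lemma one_self (x : X) : (1 : Ker X) x x = 1 := by simp [one_apply]
lemma one_ne {x y : X} (h : x ≠ y) : (1 : Ker X) x y = 0 := by simp [one_apply, h]

noncomputable instance : Semiring (Ker X) where
  add_assoc a b c := by ext x y; simp [add_apply, add_assoc]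
  zero_add a := by ext x y; simp [add_apply, zero_apply]
  add_zero a := by ext x y; simp [add_apply, zero_apply]
  add_comm a b := by ext x y; simp [add_apply, add_comm]
  nsmul := nsmulRec
  left_distrib a b c := by
    ext x y; simp [add_apply, mul_apply, mul_add, ENNReal.tsum_add]
  right_distrib a b c := by
    ext x y; simp [add_apply, mul_apply, add_mul, ENNReal.tsum_add]
  zero_mul a := by ext x y; simp [mul_apply, zero_apply]
  mul_zero a := by ext x y; simp [mul_apply, zero_apply]
  mul_assoc a b c := by
    ext x y
    simp only [mul_apply, ← ENNReal.tsum_mul_left, ← ENNReal.tsum_mul_right]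
    rw [ENNReal.tsum_comm]
    simp only [mul_assoc]
  one_mul a := by
    ext x y
    rw [mul_apply, tsum_eq_single x]
    · simp [one_self]
    · intro z hz; simp [one_ne hz.symm]
  mul_one a := by
    ext x y
    rw [mul_apply, tsum_eq_single y]
    · simp [one_self]
    · intro z hz; simp [one_ne hz]

lemma add_le_add' {p p' q q' : Ker X} (h : p ≤ p') (h' : q ≤ q') : p + q ≤ p' + q' :=
  fun x y => add_le_add (h x y) (h' x y)

lemma mul_le_mul'' {p p' q q' : Ker X} (h : p ≤ p') (h' : q ≤ q') : p * q ≤ p' * q' :=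
  fun x y => ENNReal.tsum_le_tsum fun z => mul_le_mul' (h x z) (h' z y)

lemma pow_le_pow' {p q : Ker X} (h : p ≤ q) (n : ℕ) : p ^ n ≤ q ^ n := by
  induction n with
  | zero => simp
  | succ n ih => rw [pow_succ, pow_succ]; exact mul_le_mul'' ih h

lemma zero_le' (p : Ker X) : 0 ≤ p := fun x y => (bot_le : (0:ℝ≥0∞) ≤ p x y)

lemma mul_apply_ge (p q : Ker X) (x z y : X) : p x z * q z y ≤ (p * q) x y :=
  ENNReal.le_tsum (f := fun z => p x z * q z y) z

/-- Transposed kernel. -/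
def kt (p : Ker X) : Ker X := fun x y => p y x

lemma kt_apply (p : Ker X) (x y : X) : kt p x y = p y x := rfl
lemma kt_kt (p : Ker X) : kt (kt p) = p := rfl
lemma kt_one : kt (1 : Ker X) = 1 := by
  ext x y
  by_cases h : x = y
  · rw [h]; rfl
  · rw [kt_apply, one_ne h, one_ne (Ne.symm h)]
lemma kt_mul (p q : Ker X) : kt (p * q) = kt q * kt p := by
  ext x y; simp [kt_apply, mul_apply, mul_comm]
lemma kt_pow (p : Ker X) (n : ℕ) : kt (p ^ n) = kt p ^ n := by
  induction n with
  | zero => simp [kt_one]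
  | succ n ih => rw [pow_succ, kt_mul, ih, pow_succ']

/-- Green kernel. -/
noncomputable def gr (p : Ker X) : Ker X := fun x y => ∑' n : ℕ, (p ^ n) x y

lemma gr_apply (p : Ker X) (x y : X) : gr p x y = ∑' n : ℕ, (p ^ n) x y := rfl

lemma kt_gr (p : Ker X) : kt (gr p) = gr (kt p) := by
  ext x y; simp [kt_apply, gr_apply, ← kt_pow]

lemma gr_mono {p q : Ker X} (h : p ≤ q) : gr p ≤ gr q :=
  fun x y => ENNReal.tsum_le_tsum fun n => pow_le_pow' h n x y

lemma pow_le_gr (p : Ker X) (n : ℕ) (x y : X) : (p ^ n) x y ≤ gr p x y :=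
  ENNReal.le_tsum (f := fun n => (p ^ n) x y) n

lemma gr_mul (p a : Ker X) (x y : X) : (gr p * a) x y = ∑' n : ℕ, (p ^ n * a) x y := by
  simp only [mul_apply, gr_apply, ← ENNReal.tsum_mul_right]
  rw [ENNReal.tsum_comm]

lemma mul_gr (p a : Ker X) (x y : X) : (a * gr p) x y = ∑' n : ℕ, (a * p ^ n) x y := by
  simp only [mul_apply, gr_apply, ← ENNReal.tsum_mul_left]
  rw [ENNReal.tsum_comm]

lemma gr_eq (p : Ker X) : gr p = 1 + p * gr p := by
  ext x y
  rw [add_apply, mul_gr, gr_apply, tsum_eq_zero_add' ENNReal.summable]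
  simp [pow_succ']

lemma gr_eq' (p : Ker X) : gr p = 1 + gr p * p := by
  ext x y
  rw [add_apply, gr_mul, gr_apply, tsum_eq_zero_add' ENNReal.summable]
  simp [pow_succ]

lemma sum_apply {ι : Type*} (s : Finset ι) (f : ι → Ker X) (x y : X) :
    (∑ i ∈ s, f i) x y = ∑ i ∈ s, f i x y := by
  classical
  induction s using Finset.induction_on with
  | empty => simp [zero_apply]
  | insert a s ha ih => rw [Finset.sum_insert ha, Finset.sum_insert ha, add_apply, ih]

lemma gr_le_of (p w : Ker X) (h : ∀ n : ℕ, ∑ i ∈ Finset.range n, p ^ i ≤ w) : gr p ≤ w := by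
  intro x y
  rw [gr_apply, ENNReal.tsum_eq_iSup_nat]
  refine iSup_le fun n => ?_
  rw [← sum_apply]; exact h n x y

/-- Minimality of the Green kernel. -/
lemma gr_mul_le (p a w : Ker X) (h : a + p * w ≤ w) : gr p * a ≤ w := by
  have key : ∀ n : ℕ, (∑ i ∈ Finset.range n, p ^ i * a) ≤ w := by
    intro n
    induction n with
    | zero => simpa using zero_le' w
    | succ n ih =>
      refine le_trans ?_ h
      rw [Finset.sum_range_succ', add_comm]
      refine add_le_add' (by simp) ?_
      refine le_trans ?_ (mul_le_mul'' le_rfl ih)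
      rw [Finset.mul_sum]
      simp [pow_succ', mul_assoc]
  intro x y
  rw [gr_mul, ENNReal.tsum_eq_iSup_nat]
  refine iSup_le fun n => ?_
  rw [← sum_apply]; exact key n x y

/-- Resolvent identity. -/
lemma gr_add (q r : Ker X) : gr (q + r) = gr q + gr q * r * gr (q + r) := by
  apply le_antisymm
  · apply gr_le_of
    intro n
    induction n with
    | zero =>
      rw [Finset.sum_range_zero]; exact zero_le' _
    | succ n ih =>
      have hn : ∑ i ∈ Finset.range n, (q + r) ^ i ≤ gr (q + r) := by
        intro x y
        rw [sum_apply, gr_apply]; exact ENNReal.sum_le_tsum _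
      calc ∑ i ∈ Finset.range (n + 1), (q + r) ^ i
          = 1 + (q * ∑ i ∈ Finset.range n, (q + r) ^ i) + r * ∑ i ∈ Finset.range n, (q + r) ^ i := by
            rw [Finset.sum_range_succ', add_assoc, ← add_mul, Finset.mul_sum, add_comm]
            simp [pow_succ']
        _ ≤ 1 + (q * (gr q + gr q * r * gr (q + r))) + r * gr (q + r) :=
            add_le_add' (add_le_add' le_rfl (mul_le_mul'' le_rfl ih)) (mul_le_mul'' le_rfl hn)
        _ = (1 + q * gr q) + (1 + q * gr q) * r * gr (q + r) := by noncomm_ring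
        _ = gr q + gr q * r * gr (q + r) := by rw [← gr_eq]
  · have : gr q + gr q * r * gr (q + r) = gr q * (1 + r * gr (q + r)) := by noncomm_ring
    rw [this]
    apply gr_mul_le
    conv_rhs => rw [gr_eq]
    rw [add_mul]
    apply le_of_eq
    abel

open Classical in
/-- Restriction of a kernel. -/
noncomputable def rs (D : Set X) (p : Ker X) : Ker X := fun x y => if x ∈ D ∧ y ∈ D then p x y else 0

lemma rs_of {D : Set X} (p : Ker X) {x y : X} (hx : x ∈ D) (hy : y ∈ D) : rs D p x y = p x y := by
  simp [rs, hx, hy]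
lemma rs_le (D : Set X) (p : Ker X) : rs D p ≤ p := by
  intro x y; unfold rs; split_ifs <;> simp
lemma rs_left {D : Set X} (p : Ker X) {x y : X} (hx : x ∉ D) : rs D p x y = 0 := by simp [rs, hx]
lemma rs_right {D : Set X} (p : Ker X) {x y : X} (hy : y ∉ D) : rs D p x y = 0 := by simp [rs, hy]
lemma rs_rs (D E : Set X) (p : Ker X) : rs D (rs E p) = rs (D ∩ E) p := by
  ext x y
  by_cases h : (x ∈ D ∩ E ∧ y ∈ D ∩ E)
  · rw [rs_of _ h.1.1 h.2.1, rs_of _ h.1.2 h.2.2, rs_of _ h.1 h.2]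
  · have : rs (D ∩ E) p x y = 0 := by simp only [rs, if_neg h]
    rw [this]
    by_cases h1 : x ∈ D ∧ y ∈ D
    · have h2 : ¬ (x ∈ E ∧ y ∈ E) := fun h2 => h ⟨⟨h1.1, h2.1⟩, ⟨h1.2, h2.2⟩⟩
      rw [rs_of _ h1.1 h1.2]; simp only [rs, if_neg h2]
    · simp only [rs, if_neg h1]
lemma rs_univ (p : Ker X) : rs Set.univ p = p := by ext x y; simp [rs]
lemma kt_rs (D : Set X) (p : Ker X) : kt (rs D p) = rs D (kt p) := by
  ext x y
  by_cases h : x ∈ D ∧ y ∈ D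
  · rw [kt_apply, rs_of _ h.1 h.2, rs_of _ h.2 h.1]; rfl
  · have h' : ¬ (y ∈ D ∧ x ∈ D) := fun h' => h ⟨h'.2, h'.1⟩
    rw [kt_apply]; simp only [rs, if_neg h, if_neg h']
lemma rs_mono {D E : Set X} (h : D ⊆ E) (p : Ker X) : rs D p ≤ rs E p := by
  intro x y; unfold rs; split_ifs with h1 h2
  · exact le_rfl
  · exact absurd ⟨h h1.1, h h1.2⟩ h2
  · simp
  · simp

lemma rs_pow_left {D : Set X} (p : Ker X) {x : X} (hx : x ∉ D) (n : ℕ) (y : X) :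
    (rs D p ^ (n + 1)) x y = 0 := by
  rw [pow_succ', mul_apply]; simp [rs_left p hx]
lemma rs_pow_right {D : Set X} (p : Ker X) {y : X} (hy : y ∉ D) (n : ℕ) (x : X) :
    (rs D p ^ (n + 1)) x y = 0 := by
  rw [pow_succ, mul_apply]; simp [rs_right p hy]

lemma gr_rs_left {D : Set X} (p : Ker X) {x : X} (hx : x ∉ D) (y : X) :
    gr (rs D p) x y = (1 : Ker X) x y := by
  rw [gr_apply, tsum_eq_zero_add' ENNReal.summable]
  simp [rs_pow_left p hx]
lemma gr_rs_right {D : Set X} (p : Ker X) {y : X} (hy : y ∉ D) (x : X) :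
    gr (rs D p) x y = (1 : Ker X) x y := by
  rw [gr_apply, tsum_eq_zero_add' ENNReal.summable]
  simp [rs_pow_right p hy]

open Classical in
/-- First-entrance kernel into `B`. -/
noncomputable def ent (B : Set X) (p : Ker X) : Ker X := fun x b =>
  if b ∈ B then ∑' z, (if z ∈ B then 0 else gr (rs Bᶜ p) x z * p z b) else 0

lemma ent_not {B : Set X} (p : Ker X) (x : X) {b : X} (hb : b ∉ B) : ent B p x b = 0 := by
  simp [ent, hb]

/-- Decomposition at the first entrance. -/
lemma gr_ent (B : Set X) (p : Ker X) {x : X} (hx : x ∉ B) (v : X) :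
    gr p x v = gr (rs Bᶜ p) x v + ∑' b, ent B p x b * gr p b v := by
  classical
  set r : Ker X := fun x y => if x ∈ Bᶜ ∧ y ∈ Bᶜ then 0 else p x y with hr
  have hp : p = rs Bᶜ p + r := by
    ext x y
    rw [add_apply, hr]; simp only [rs]
    split_ifs <;> simp
  have key := gr_add (rs Bᶜ p) r
  rw [← hp] at key
  have := congrFun (congrFun key x) v
  rw [this, add_apply, mul_apply]
  congr 1
  refine tsum_congr fun b => ?_
  congr 1
  rw [mul_apply]
  by_cases hb : b ∈ B
  · rw [ent, if_pos hb]
    refine tsum_congr fun z => ?_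
    by_cases hz : z ∈ B
    · rw [if_pos hz, gr_rs_right p (by simpa using hz), one_ne (by rintro rfl; exact hx hz), zero_mul]
    · rw [if_neg hz, hr]; simp [hb]
  · rw [ent_not p x hb, ENNReal.tsum_eq_zero]
    intro z
    by_cases hz : z ∈ B
    · rw [gr_rs_right p (by simpa using hz), one_ne (by rintro rfl; exact hx hz), zero_mul]
    · rw [hr]; simp [hb, hz]

lemma gr_consumer (D B : Set X) (q : Ker X) (x v p : X) (M : ℝ≥0∞) (hx : x ∈ D)
    (h : ∀ b ∈ B ∩ D, gr (rs D q) b v ≤ M * gr (rs D q) b p) :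
    gr (rs D q) x v ≤ gr (rs (D \ B) q) x v + M * gr (rs D q) x p := by
  by_cases hxB : x ∈ B
  · exact (h x ⟨hxB, hx⟩).trans le_add_self
  rw [gr_ent B (rs D q) hxB v, rs_rs, show Bᶜ ∩ D = D \ B by ext; simp [and_comm]]
  gcongr
  rw [gr_ent B (rs D q) hxB p, mul_add]
  refine le_trans ?_ le_add_self
  rw [← ENNReal.tsum_mul_left]
  refine ENNReal.tsum_le_tsum fun b => ?_
  by_cases hb : b ∈ B ∩ D
  · calc _ ≤ ent B (rs D q) x b * (M * gr (rs D q) b p) := by gcongr; exact h b hb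
      _ = _ := by ring
  · have : ent B (rs D q) x b = 0 := by
      by_cases hbB : b ∈ B
      · have hbD : b ∉ D := fun h => hb ⟨hbB, h⟩
        simp [ent, rs_right q hbD]
      · exact ent_not _ _ hbB
    simp [this]

lemma gr_consumer' (D B : Set X) (q : Ker X) (x v p : X) (M : ℝ≥0∞) (hx : x ∈ D)
    (h : ∀ b ∈ B ∩ D, gr (rs D q) v b ≤ M * gr (rs D q) p b) :
    gr (rs D q) v x ≤ gr (rs (D \ B) q) v x + M * gr (rs D q) p x := by
  have := gr_consumer D B (kt q) x v p M hx
  simp only [← kt_rs, ← kt_gr, kt_apply] at this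
  exact this h

lemma gr_mul_le_gr (q : Ker X) (x y z : X) :
    gr q x y * gr q y z ≤ gr q y y * gr q x z := by
  by_cases hxy : x = y
  · rw [hxy]
  have hx : x ∉ ({y} : Set X) := hxy
  have h1 := gr_ent {y} q hx y
  have h2 := gr_ent {y} q hx z
  have e : ∀ v, ∑' b, ent {y} q x b * gr q b v = ent {y} q x y * gr q y v := by
    intro v
    refine tsum_eq_single y fun b hb => ?_
    rw [ent_not q x (b := b) (B := {y}) (by simpa using hb), zero_mul]
  rw [e] at h1 h2
  rw [gr_rs_right q (by simp), one_ne hxy, zero_add] at h1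
  rw [h1, h2, mul_add]
  refine le_trans (le_of_eq ?_) le_add_self
  ring

end Ker

/-! ### Ancona inequalities in star-shaped domains -/

open Ker

structure Good (S : Set Γ) (q : Ker Γ) (N : ℕ) (c C ρ : ℝ≥0∞) : Prop where
  range : ∀ x y, q x y ≠ 0 → dd S x y ≤ N
  lower : ∀ x y, dd S x y ≤ 1 → c ≤ q x y
  decay : ∀ n x y, (q ^ n) x y ≤ C * ρ ^ n
  c0 : c ≠ 0
  c1 : c ≤ 1
  C1 : C ≠ ⊤
  ρ1 : ρ < 1

lemma path_gp {S : Set Γ} {δ : ℝ} (hS : IsGenSet S) (hδ : IsHyperbolic S δ) {q : Ker Γ} {N : ℕ}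
    (hq : ∀ x y, q x y ≠ 0 → dd S x y ≤ N) (D : Set Γ) (o : Γ) (r : ℝ)
    (hD : ∀ x ∈ D, r ≤ dd S x o) (k : ℕ) : ∀ (n : ℕ), n ≤ 2 ^ k → ∀ w v : Γ, w ∈ D →
    (rs D q ^ n) w v ≠ 0 → v ∈ D ∧ r - N - k * δ ≤ gp S o w v := by
  have hδ0 := hδ.1
  have hN : (0 : ℝ) ≤ N := by positivity
  induction k with
  | zero =>
    intro n hn w v hw h
    have : n = 0 ∨ n = 1 := by simp at hn; omega
    rcases this with rfl | rfl
    · rw [pow_zero] at h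
      have : w = v := by
        by_contra hc; exact h (one_ne hc)
      subst this
      have := hD w hw
      refine ⟨hw, ?_⟩
      rw [gp_eq, dd_self]; push_cast; linarith
    · rw [pow_one] at h
      have hv : v ∈ D := by
        by_contra hc; exact h (rs_right q hc)
      rw [rs_of q hw hv] at h
      have h1 := hq _ _ h
      have := hD w hw
      have := hD v hv
      refine ⟨hv, ?_⟩
      rw [gp_eq]; push_cast; linarith
  | succ k ih =>
    intro n hn w v hw h
    obtain ⟨a, b, ha, hb, rfl⟩ : ∃ a b, a ≤ 2 ^ k ∧ b ≤ 2 ^ k ∧ n = a + b := by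
      rw [pow_succ] at hn
      exact ⟨n / 2, n - n / 2, by omega, by omega, by omega⟩
    rw [pow_add, mul_apply] at h
    obtain ⟨z, hz⟩ : ∃ z, (rs D q ^ a) w z * (rs D q ^ b) z v ≠ 0 := by
      by_contra hc
      push Not at hc
      exact h (ENNReal.tsum_eq_zero.2 hc)
    obtain ⟨h1, h2⟩ := ih a ha w z hw (left_ne_zero_of_mul hz)
    obtain ⟨h3, h4⟩ := ih b hb z v h1 (right_ne_zero_of_mul hz)
    refine ⟨h3, ?_⟩
    have e := gp_comm hS o z v
    push_cast
    rcases gp_hyp hS hδ o w v z with h5 | h5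
    · linarith
    · linarith

lemma eventually_pow_large (A : ℕ) : ∀ᶠ k : ℕ in atTop, A * (k + 1) ≤ 2 ^ k := by
  have h := tendsto_pow_const_div_const_pow_of_one_lt 1 (r := (2 : ℝ)) (by norm_num)
  have h2 : ∀ᶠ k : ℕ in atTop, (k : ℝ) ^ 1 / 2 ^ k < 1 / (2 * (A + 1)) :=
    h.eventually_lt_const (by positivity)
  filter_upwards [h2, eventually_ge_atTop 1] with k hk hk1
  rw [div_lt_div_iff₀ (by positivity) (by positivity)] at hk
  have hk1' : (1 : ℝ) ≤ k := by exact_mod_cast hk1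
  have : ((A * (k + 1) : ℕ) : ℝ) ≤ ((2 ^ k : ℕ) : ℝ) := by
    push_cast
    have hA : (0 : ℝ) ≤ A := by positivity
    nlinarith
  exact_mod_cast this

lemma tail_steps {S : Set Γ} {δ : ℝ} (hS : IsGenSet S) (hδ : IsHyperbolic S δ) {q : Ker Γ} {N : ℕ}
    (hq : ∀ x y, q x y ≠ 0 → dd S x y ≤ N) (κ : ℝ) (K : ℕ) :
    ∃ s0 : ℕ, ∀ s : ℕ, s0 ≤ s → ∀ (D : Set Γ) (o : Γ), (∀ x ∈ D, (s : ℝ) ≤ dd S x o) →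
      ∀ w ∈ D, ∀ v, gp S o w v ≤ κ → ∀ n : ℕ, n ≤ K * s → (rs D q ^ n) w v = 0 := by
  have hδ0 := hδ.1
  obtain ⟨d, hd⟩ := exists_nat_gt δ
  have hd0 : 0 < d := by
    have : (0 : ℝ) < d := by linarith
    exact_mod_cast this
  have hten : Tendsto (fun s : ℕ => s / (2 * d)) atTop atTop :=
    Nat.tendsto_div_const_atTop (by omega)
  have hev := hten.eventually (eventually_pow_large (K * (2 * d)))
  obtain ⟨s1, hs1⟩ := eventually_atTop.1 hev
  obtain ⟨s2, hs2⟩ := exists_nat_gt (2 * (N + κ))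
  refine ⟨max s1 s2, fun s hs D o hD w hw v hgp n hn => ?_⟩
  by_contra hne
  have h1 := hs1 s (le_trans (le_max_left _ _) hs)
  have h2 : (s2 : ℝ) ≤ s := by exact_mod_cast le_trans (le_max_right _ _) hs
  set k := s / (2 * d) with hk
  have hk1 : s ≤ 2 * d * (k + 1) := by
    have := Nat.lt_mul_div_succ s (show 0 < 2 * d by omega)
    rw [hk]; exact this.le
  have hk2 : k * (2 * d) ≤ s := Nat.div_mul_le_self _ _
  have hk3 : (k : ℝ) * (2 * d) ≤ s := by exact_mod_cast hk2
  have h3 := (path_gp hS hδ hq D o s hD k n (by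
    calc n ≤ K * s := hn
      _ ≤ K * (2 * d * (k + 1)) := Nat.mul_le_mul_left _ hk1
      _ = K * (2 * d) * (k + 1) := by ring
      _ ≤ 2 ^ k := h1) w v hw hne).2
  have h4 : (k : ℝ) * δ ≤ k * d := by gcongr
  linarith

lemma tail_green {S : Set Γ} {δ : ℝ} (hS : IsGenSet S) (hδ : IsHyperbolic S δ) {q : Ker Γ} {N : ℕ}
    {c C ρ : ℝ≥0∞} (hq : Good S q N c C ρ) (κ : ℝ) (η : ℝ≥0∞) (hη : η ≠ 0) :
    ∃ s0 : ℕ, 0 < s0 ∧ ∀ s : ℕ, s0 ≤ s → ∀ (D : Set Γ) (o : Γ), (∀ x ∈ D, (s : ℝ) ≤ dd S x o) →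
      ∀ w ∈ D, ∀ v, gp S o w v ≤ κ → gr (rs D q) w v ≤ η ^ s := by
  set A : ℝ≥0∞ := C * (1 - ρ)⁻¹ + 1 with hA
  have h1ρ : 1 - ρ ≠ 0 := (tsub_pos_of_lt hq.ρ1).ne'
  have hAtop : A ≠ ⊤ := by
    rw [hA]
    exact ENNReal.add_ne_top.2 ⟨ENNReal.mul_ne_top hq.C1 (ENNReal.inv_ne_top.2 h1ρ), by simp⟩
  obtain ⟨K, hK⟩ : ∃ K : ℕ, ρ ^ K < η / A := by
    have h := ENNReal.tendsto_pow_atTop_nhds_zero_of_lt_one hq.ρ1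
    exact (h.eventually_lt_const (ENNReal.div_pos hη hAtop)).exists
  obtain ⟨s0, hs0⟩ := tail_steps hS hδ hq.range κ K
  refine ⟨s0 + 1, by omega, fun s hs D o hD w hw v hgp => ?_⟩
  have hz := hs0 s (by omega) D o hD w hw v hgp
  have hA1 : 1 ≤ A := le_add_self
  have hterm : ∀ n, (rs D q ^ n) w v ≤ C * ρ ^ n := fun n =>
    (pow_le_pow' (rs_le D q) n w v).trans (hq.decay n w v)
  rw [gr_apply, ← Summable.sum_add_tsum_nat_add' (k := K * s) ENNReal.summable,
    Finset.sum_eq_zero (fun n hn => hz n (Finset.mem_range.1 hn).le), zero_add]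
  calc ∑' i, (rs D q ^ (i + K * s)) w v ≤ ∑' i, C * ρ ^ (K * s) * ρ ^ i := by
        refine ENNReal.tsum_le_tsum fun i => (hterm _).trans (le_of_eq ?_)
        rw [pow_add]; ring
    _ = C * (1 - ρ)⁻¹ * (ρ ^ K) ^ s := by
        rw [ENNReal.tsum_mul_left, ENNReal.tsum_geometric, pow_mul]; ring
    _ ≤ A ^ s * (η / A) ^ s := by
        gcongr
        exact (le_self_add).trans (le_self_pow₀ hA1 (by omega))
    _ = η ^ s := by
        rw [← mul_pow, ENNReal.mul_div_cancel (by positivity) hAtop]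

/-- `D` is star-shaped about `p`. -/
def Star (S : Set Γ) (p : Γ) (D : Set Γ) : Prop :=
  p ∈ D ∧ ∀ w ∈ D, w ≠ p → ∃ w' ∈ D, dd S w w' ≤ 1 ∧ dd S w' p = dd S w p - 1

lemma star_lower {S : Set Γ} (hS : IsGenSet S) {q : Ker Γ} {c : ℝ≥0∞}
    (hq : ∀ x y, dd S x y ≤ 1 → c ≤ q x y) {p : Γ} {D : Set Γ} (hD : Star S p D) (n : ℕ) :
    ∀ w ∈ D, dd S w p = n → c ^ n ≤ gr (rs D q) w p := by
  induction n with
  | zero =>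
    intro w hw h
    have : w = p := dd_eq_zero hS (by simpa using h)
    rw [this, gr_eq, add_apply, one_self]; simp
  | succ n ih =>
    intro w hw h
    have hwp : w ≠ p := by
      rintro rfl; rw [dd_self] at h; push_cast at h; linarith
    obtain ⟨w', hw', h1, h2⟩ := hD.2 w hw hwp
    have h3 := ih w' hw' (by rw [h2, h]; push_cast; ring)
    rw [gr_eq, add_apply, pow_succ']
    refine le_trans ?_ le_add_self
    refine le_trans ?_ (mul_apply_ge _ _ w w' p)
    rw [rs_of q hw hw']
    exact mul_le_mul' (hq _ _ h1) h3

lemma star_lower_le {S : Set Γ} (hS : IsGenSet S) {q : Ker Γ} {N : ℕ}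
    {c C ρ : ℝ≥0∞} (hq : Good S q N c C ρ) {p : Γ} {D : Set Γ} (hD : Star S p D) (n : ℕ)
    (w : Γ) (hw : w ∈ D) (h : dd S w p ≤ n) :
    c ^ n ≤ gr (rs D q) w p ∧ c ^ n ≤ gr (rs D q) p w := by
  have h0 : wdist S w p ≤ n := by unfold dd at h; exact_mod_cast h
  have h1 := star_lower hS hq.lower hD (wdist S w p) w hw rfl
  have h2 := star_lower (q := kt q) hS (c := c) (fun x y h => by
    rw [dd_comm hS] at h; exact hq.lower _ _ h) hD (wdist S w p) w hw rfl
  rw [← kt_rs, ← kt_gr, kt_apply] at h2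
  have h3 : c ^ n ≤ c ^ (wdist S w p) := pow_le_pow_right_of_le_one' hq.c1 h0
  exact ⟨h3.trans h1, h3.trans h2⟩

lemma gr_bound {S : Set Γ} {q : Ker Γ} {N : ℕ}
    {c C ρ : ℝ≥0∞} (hq : Good S q N c C ρ) : ∃ A : ℝ≥0∞, A ≠ ⊤ ∧ 1 ≤ A ∧ ∀ D x y, gr (rs D q) x y ≤ A := by
  have h1ρ : 1 - ρ ≠ 0 := (tsub_pos_of_lt hq.ρ1).ne'
  refine ⟨C * (1 - ρ)⁻¹ + 1, ENNReal.add_ne_top.2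
    ⟨ENNReal.mul_ne_top hq.C1 (ENNReal.inv_ne_top.2 h1ρ), by simp⟩, le_add_self, fun D x y => ?_⟩
  refine le_trans ?_ le_self_add
  rw [gr_apply, ← ENNReal.tsum_geometric, ← ENNReal.tsum_mul_left]
  exact ENNReal.tsum_le_tsum fun n => (pow_le_pow' (rs_le D q) n x y).trans (hq.decay n x y)

/-- The shells used in the induction for the Ancona inequality. -/
def shell (S : Set Γ) (p x : Γ) (s : ℕ) : Set Γ :=
  {w | dd S w p ≤ 11 * s ∧ (w = x ∨ 9 * s ≤ gp S p w x)}

lemma gp_self_eq (S : Set Γ) (p x : Γ) : gp S p x x = dd S x p := by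
  rw [gp_eq, dd_self]; ring

lemma gp_le_left {S : Set Γ} (hS : IsGenSet S) (p x y : Γ) : gp S p x y ≤ dd S x p := by
  rw [gp_eq]
  have := dd_tri hS y x p
  rw [dd_comm hS y x] at this
  linarith

lemma gp_le_right {S : Set Γ} (hS : IsGenSet S) (p x y : Γ) : gp S p x y ≤ dd S y p := by
  rw [gp_comm hS]; exact gp_le_left hS p y x

/-- geometry of one induction step -/
lemma shell_step {S : Set Γ} {δ : ℝ} (hS : IsGenSet S) (hδ : IsHyperbolic S δ) {κ : ℝ}
    {p x z : Γ} (hxz : gp S p x z ≤ κ) {s t : ℕ} (hs : κ + 2 * δ < s) (hst : s ≤ t)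
    {w v : Γ} (hw : w ∈ shell S p x (2 * s)) (hw' : w ∉ shell S p x s) (hv : v ∈ shell S p z t) :
    ∃ o : Γ, gp S o w v ≤ κ + 3 * δ ∧ gp S o v w ≤ κ + 3 * δ ∧
      (∀ b, dd S b o ≤ s → b ∈ shell S p x s) := by
  have hδ0 := hδ.1
  have hs0 : (0 : ℝ) ≤ s := by positivity
  have hstR : (s : ℝ) ≤ t := by exact_mod_cast hst
  have hgw : 10 * (s : ℝ) ≤ gp S p w x := by
    obtain ⟨h1, h2⟩ := hw
    push_cast at h1 h2
    rcases h2 with h2 | h2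
    · subst h2
      rw [gp_self_eq]
      by_contra hc
      exact hw' ⟨by linarith, Or.inl rfl⟩
    · linarith
  have hdx : 10 * (s : ℝ) ≤ dd S p x := by
    rw [dd_comm hS]; exact hgw.trans (gp_le_right hS p w x)
  obtain ⟨o, ho1, ho2⟩ := dd_split hS p x (10 * s) (by push_cast; exact hdx)
  push_cast at ho1 ho2
  have hox : gp S p x o = 10 * s := by
    rw [gp_eq, dd_comm hS x p, dd_comm hS o p, ho1, dd_comm hS x o, ho2]; ring
  have hwo : 10 * s - δ ≤ gp S p w o := by
    rcases gp_hyp hS hδ p w o x with h | h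
    · linarith
    · rw [gp_comm hS] at h; linarith
  -- (w|v)_p small
  have hwv : gp S p w v ≤ κ + 2 * δ := by
    rcases hv.2 with h | h
    · subst h
      rcases gp_hyp hS hδ p x v w with h | h
      · rw [gp_comm hS p x w] at h; linarith
      · rw [gp_comm hS p v w] at h; linarith
    · have h0 : gp S p x v ≤ κ + δ := by
        rcases gp_hyp hS hδ p x z v with h' | h'
        · linarith
        · rw [gp_comm hS p z v] at h'; linarith
      rcases gp_hyp hS hδ p x v w with h' | h'
      · rw [gp_comm hS p x w] at h'; linarith
      · rw [gp_comm hS p v w] at h'; linarith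
  have hmain : gp S o w v ≤ κ + 3 * δ := by
    rw [gp_eq] at hwo hwv ⊢
    rw [dd_comm hS o p, ho1] at hwo
    have := dd_tri hS v p o
    linarith
  refine ⟨o, hmain, by rw [gp_comm hS]; exact hmain, fun b hb => ?_⟩
  have h1 := dd_tri hS b o p
  rw [dd_comm hS o p, ho1] at h1
  refine ⟨by linarith, Or.inr ?_⟩
  rw [gp_eq] at hox ⊢
  have h2 := dd_tri hS o b p
  have h3 := dd_tri hS b o x
  rw [dd_comm hS o b, dd_comm hS o p] at h2
  rw [dd_comm hS o p, dd_comm hS x o] at hox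
  linarith

lemma pow_balance {c : ℝ≥0∞} (hc0 : c ≠ 0) (hc1 : c ≤ 1) (s : ℕ) (g1 g2 : ℝ≥0∞)
    (h1 : c ^ (22 * s) ≤ g1) (h2 : c ^ (22 * s) ≤ g2) :
    (c ^ 44 / 2) ^ s ≤ 2⁻¹ ^ s * (g1 * g2) := by
  calc (c ^ 44 / 2) ^ s = 2⁻¹ ^ s * (c ^ (22 * s) * c ^ (22 * s)) := by
        rw [div_eq_mul_inv, mul_pow, ← pow_mul, ← pow_add, mul_comm]; ring_nf
    _ ≤ _ := by gcongr

/-- **Ancona's inequality** in domains that are star-shaped about the intermediate point. -/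
lemma ancona {S : Set Γ} {δ : ℝ} (hS : IsGenSet S) (hδ : IsHyperbolic S δ) {q : Ker Γ} {N : ℕ}
    {c C ρ : ℝ≥0∞} (hq : Good S q N c C ρ) (κ : ℝ) :
    ∃ A : ℝ≥0∞, A ≠ ⊤ ∧ 1 ≤ A ∧ ∀ (p : Γ) (D : Set Γ), Star S p D → ∀ x ∈ D, ∀ z ∈ D, gp S p x z ≤ κ →
      gr (rs D q) x z ≤ A * (gr (rs D q) x p * gr (rs D q) p z) := by
  obtain ⟨G0, hG0, hG1, hGb⟩ := gr_bound hq
  have hctop : c ≠ ⊤ := ne_top_of_le_ne_top (by simp) hq.c1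
  have hη : c ^ 44 / 2 ≠ 0 := ENNReal.div_ne_zero.2 ⟨pow_ne_zero _ hq.c0, by simp⟩
  obtain ⟨s1, hs1, htail⟩ := tail_green hS hδ hq (κ + 3 * δ) (c ^ 44 / 2) hη
  obtain ⟨s2, hs2⟩ := exists_nat_gt (κ + 2 * δ)
  set s0 := max s1 s2 with hs0
  have hs01 : s1 ≤ s0 := le_max_left _ _
  have hs02 : (s2 : ℝ) ≤ s0 := by exact_mod_cast le_max_right _ _
  have hs0pos : 0 < s0 := by omega
  set C0 : ℝ≥0∞ := G0 / (c ^ (11 * s0) * c ^ (11 * s0)) with hC0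
  have hC0top : C0 ≠ ⊤ := by
    rw [hC0]
    refine ENNReal.div_ne_top hG0 (mul_ne_zero (pow_ne_zero _ hq.c0) (pow_ne_zero _ hq.c0))
  refine ⟨C0 + 4, ENNReal.add_ne_top.2 ⟨hC0top, by simp⟩, ?_, fun p D hD x hx z hz hxz => ?_⟩
  · exact le_trans (by norm_num) (le_add_self : (4 : ℝ≥0∞) ≤ C0 + 4)
  set G := gr (rs D q) with hG
  set CC : ℕ → ℝ≥0∞ := fun k => C0 + ∑ i ∈ Finset.range k, 2 * 2⁻¹ ^ i with hCC
  have hlow : ∀ (n : ℕ) w, w ∈ D → dd S w p ≤ n → c ^ n ≤ G w p ∧ c ^ n ≤ G p w :=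
    fun n w hw h => star_lower_le hS hq hD n w hw h
  have hP : ∀ k : ℕ, ∀ w ∈ shell S p x (2 ^ k * s0) ∩ D, ∀ v ∈ shell S p z (2 ^ k * s0) ∩ D,
      G w v ≤ CC k * (G w p * G p v) := by
    intro k
    induction k with
    | zero =>
      intro w hw v hv
      simp only [hCC, Finset.range_zero, Finset.sum_empty, add_zero, pow_zero, one_mul] at hw hv ⊢
      have h1 := (hlow (11 * s0) w hw.2 (by push_cast; exact hw.1.1)).1
      have h2 := (hlow (11 * s0) v hv.2 (by push_cast; exact hv.1.1)).2
      refine (hGb D w v).trans ?_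
      have hne : c ^ (11 * s0) * c ^ (11 * s0) ≠ 0 :=
        mul_ne_zero (pow_ne_zero _ hq.c0) (pow_ne_zero _ hq.c0)
      have hnt : c ^ (11 * s0) * c ^ (11 * s0) ≠ ⊤ :=
        ENNReal.mul_ne_top (ENNReal.pow_ne_top hctop) (ENNReal.pow_ne_top hctop)
      calc G0 = C0 * (c ^ (11 * s0) * c ^ (11 * s0)) := by
            rw [hC0, ENNReal.div_mul_cancel hne hnt]
        _ ≤ _ := by gcongr
    | succ k ih =>
      set s := 2 ^ k * s0 with hs
      have hss : 2 ^ (k + 1) * s0 = 2 * s := by rw [hs, pow_succ]; ring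
      have hs0s : s0 ≤ s := Nat.le_mul_of_pos_left _ (by positivity)
      have hsκ : κ + 2 * δ < s := by
        have : (s0 : ℝ) ≤ s := by exact_mod_cast hs0s
        linarith
      have hks : k ≤ s := by
        have : k < 2 ^ k := Nat.lt_two_pow_self
        calc k ≤ 2 ^ k := this.le
          _ ≤ s := Nat.le_mul_of_pos_right _ hs0pos
      have hpow : (2⁻¹ : ℝ≥0∞) ^ s ≤ 2⁻¹ ^ k := pow_le_pow_right_of_le_one' (by simp) hks
      rw [hss]
      -- first stage
      have stage1 : ∀ w ∈ shell S p x (2 * s) ∩ D, ∀ v ∈ shell S p z s ∩ D,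
          G w v ≤ (CC k + 2⁻¹ ^ k) * (G w p * G p v) := by
        intro w hw v hv
        by_cases hws : w ∈ shell S p x s
        · exact (ih w ⟨hws, hw.2⟩ v hv).trans (by gcongr; exact le_self_add)
        obtain ⟨o, ho1, -, ho2⟩ := shell_step hS hδ hxz hsκ le_rfl hw.1 hws hv.1
        have h1 := gr_consumer D {b | dd S b o ≤ s} q w v p (CC k * G p v) hw.2 (by
          intro b hb
          refine (ih b ⟨ho2 b hb.1, hb.2⟩ v hv).trans (le_of_eq ?_)
          ring)
        have h2 := htail s (hs01.trans hs0s) (D \ {b | dd S b o ≤ s}) o (by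
          intro b hb; exact (not_le.1 hb.2).le) w ⟨hw.2, fun h => hws (ho2 w h)⟩ v ho1
        have h3 := pow_balance hq.c0 hq.c1 s (G w p) (G p v)
          ((hlow (22 * s) w hw.2 (by have := hw.1.1; push_cast at this ⊢; linarith)).1)
          ((hlow (22 * s) v hv.2 (by
            have := hv.1.1
            have h0 : (0 : ℝ) ≤ s := by positivity
            push_cast at this ⊢; linarith)).2)
        calc G w v ≤ _ := h1
          _ ≤ 2⁻¹ ^ k * (G w p * G p v) + CC k * G p v * G w p := by
            gcongr
            exact (h2.trans h3).trans (by gcongr)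
          _ = _ := by ring
      intro w hw v hv
      have hCCs : CC (k + 1) = CC k + 2⁻¹ ^ k + 2⁻¹ ^ k := by
        simp only [hCC, Finset.sum_range_succ]; ring
      rw [hCCs]
      by_cases hvs : v ∈ shell S p z s
      · exact (stage1 w hw v ⟨hvs, hv.2⟩).trans (by gcongr; exact le_self_add)
      obtain ⟨o, -, ho1, ho2⟩ := shell_step hS hδ (t := 2 * s) (by rwa [gp_comm hS]) hsκ (by omega) hv.1 hvs hw.1
      have h1 := gr_consumer' D {b | dd S b o ≤ s} q v w p ((CC k + 2⁻¹ ^ k) * G w p) hv.2 (by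
        intro b hb
        refine (stage1 w hw b ⟨ho2 b hb.1, hb.2⟩).trans (le_of_eq ?_)
        ring)
      have h2 : gr (rs (D \ {b | dd S b o ≤ s}) q) w v ≤ (c ^ 44 / 2) ^ s := by
        have hvB : v ∈ D \ {b | dd S b o ≤ s} := ⟨hv.2, fun h => hvs (ho2 v h)⟩
        by_cases hwB : dd S w o ≤ s
        · rw [gr_rs_left q (by intro h; exact h.2 hwB), one_ne]
          · simp
          · rintro rfl; exact hvB.2 hwB
        · exact htail s (hs01.trans hs0s) (D \ {b | dd S b o ≤ s}) o (by
            intro b hb; exact (not_le.1 hb.2).le) w ⟨hw.2, hwB⟩ v ho1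
      have h3 := pow_balance hq.c0 hq.c1 s (G w p) (G p v)
        ((hlow (22 * s) w hw.2 (by have := hw.1.1; push_cast at this ⊢; linarith)).1)
        ((hlow (22 * s) v hv.2 (by have := hv.1.1; push_cast at this ⊢; linarith)).2)
      calc G w v ≤ _ := h1
        _ ≤ 2⁻¹ ^ k * (G w p * G p v) + (CC k + 2⁻¹ ^ k) * G w p * G p v := by
          gcongr
          exact (h2.trans h3).trans (by gcongr)
        _ = _ := by ring
  -- conclusion
  have hCCle : ∀ k, CC k ≤ C0 + 4 := by
    intro k
    simp only [hCC]
    gcongr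
    rw [← Finset.mul_sum]
    calc 2 * ∑ i ∈ Finset.range k, (2⁻¹ : ℝ≥0∞) ^ i ≤ 2 * ∑' i : ℕ, (2⁻¹ : ℝ≥0∞) ^ i := by
          gcongr; exact ENNReal.sum_le_tsum _
      _ = 4 := by
          rw [ENNReal.tsum_geometric, ENNReal.one_sub_inv_two, inv_inv]; norm_num
  set k := wdist S x p + wdist S z p with hk
  have hbig : k ≤ 11 * (2 ^ k * s0) := by
    have : k < 2 ^ k := Nat.lt_two_pow_self
    have h2 : 2 ^ k ≤ 2 ^ k * s0 := Nat.le_mul_of_pos_right _ hs0pos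
    omega
  have hbig' : (k : ℝ) ≤ 11 * ((2 ^ k * s0 : ℕ) : ℝ) := by exact_mod_cast hbig
  have hkk : (k : ℝ) = dd S x p + dd S z p := by rw [hk]; push_cast; rfl
  have hxk : x ∈ shell S p x (2 ^ k * s0) := ⟨by have := dd_nonneg S z p; linarith, Or.inl rfl⟩
  have hzk : z ∈ shell S p z (2 ^ k * s0) := ⟨by have := dd_nonneg S x p; linarith, Or.inl rfl⟩
  exact (hP k x ⟨hxk, hx⟩ z ⟨hzk, hz⟩).trans (by gcongr; exact hCCle k)

/-! ### Contraction -/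

/-- One oscillation-reduction step. -/
lemma contract_step {X : Type} (E : Set X) (e : X → X → ℝ≥0∞) (α β h1 h2 : X → ℝ≥0∞)
    (κ θ m w : ℝ≥0∞) (hκθ : θ + κ = 1) (hm : m ≠ ⊤) (hw : w ≠ ⊤)
    (B : ℝ≥0∞) (hB : B = ∑' a, β a * h2 a) (hB0 : B ≠ 0) (hBt : B ≠ ⊤) 
    (hh2 : ∀ a, h2 a ≠ ⊤) (G0 C0 : ℝ≥0∞) (hκ : κ * (G0 * C0) ≤ 1)
    (e1 : ∀ x ∈ E, h1 x = ∑' a, e x a * h1 a) (e2 : ∀ x ∈ E, h2 x = ∑' a, e x a * h2 a)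
    (hup : ∀ x ∈ E, ∀ a, e x a ≤ C0 * (α x * β a))
    (hlo : ∀ x ∈ E, ∀ a, α x * β a ≤ G0 * e x a)
    (hcmp : ∀ a, β a ≠ 0 → m * h2 a ≤ h1 a ∧ h1 a ≤ (m + w) * h2 a) :
    ∃ m' : ℝ≥0∞, m ≤ m' ∧ m' ≠ ⊤ ∧ ∀ x ∈ E, m' * h2 x ≤ h1 x ∧ h1 x ≤ (m' + θ * w) * h2 x := by
  have hκ1 : κ ≤ 1 := by rw [← hκθ]; exact le_add_self
  have hκt : κ ≠ ⊤ := ne_top_of_le_ne_top (by simp) hκ1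
  have hθt : θ ≠ ⊤ := ne_top_of_le_ne_top (by simp) (by rw [← hκθ]; exact le_self_add : θ ≤ 1)
  set u : X → ℝ≥0∞ := fun a => h1 a - m * h2 a with hu
  set v : X → ℝ≥0∞ := fun a => (m + w) * h2 a - h1 a with hv
  have hu1 : ∀ a, β a ≠ 0 → m * h2 a + u a = h1 a := fun a ha =>
    add_tsub_cancel_of_le (hcmp a ha).1
  have hv1 : ∀ a, β a ≠ 0 → h1 a + v a = (m + w) * h2 a := fun a ha =>
    add_tsub_cancel_of_le (hcmp a ha).2
  have huv : ∀ a, β a ≠ 0 → u a + v a = w * h2 a := by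
    intro a ha
    have h := hv1 a ha
    rw [← hu1 a ha, add_assoc, add_mul] at h
    exact (ENNReal.add_right_inj (ENNReal.mul_ne_top hm (hh2 a))).1 h
  set U := ∑' a, β a * u a with hU
  set V := ∑' a, β a * v a with hV
  have hUV : U + V = w * B := by
    rw [hU, hV, hB, ← ENNReal.tsum_add, ← ENNReal.tsum_mul_left]
    refine tsum_congr fun a => ?_
    by_cases ha : β a = 0
    · simp [ha]
    · rw [← mul_add, huv a ha]; ring
  have hwB : w * B ≠ ⊤ := ENNReal.mul_ne_top hw hBt
  have hUt : U ≠ ⊤ := ne_top_of_le_ne_top hwB (by rw [← hUV]; exact le_self_add)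
  have hVt : V ≠ ⊤ := ne_top_of_le_ne_top hwB (by rw [← hUV]; exact le_add_self)
  -- key estimate
  have key : ∀ f : X → ℝ≥0∞, ∀ x ∈ E, κ * ((∑' a, β a * f a) / B) * h2 x ≤ ∑' a, e x a * f a := by
    intro f x hx
    have h2le : h2 x ≤ C0 * (α x * B) := by
      rw [e2 x hx, hB, ← ENNReal.tsum_mul_left, ← ENNReal.tsum_mul_left]
      refine ENNReal.tsum_le_tsum fun a => ?_
      calc e x a * h2 a ≤ C0 * (α x * β a) * h2 a := by gcongr; exact hup x hx a
        _ = _ := by ring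
    have hge : α x * (∑' a, β a * f a) ≤ G0 * ∑' a, e x a * f a := by
      rw [← ENNReal.tsum_mul_left, ← ENNReal.tsum_mul_left]
      refine ENNReal.tsum_le_tsum fun a => ?_
      calc α x * (β a * f a) = α x * β a * f a := by ring
        _ ≤ G0 * e x a * f a := by gcongr ?_ * _; exact hlo x hx a
        _ = _ := by ring
    set F := ∑' a, β a * f a
    calc κ * (F / B) * h2 x ≤ κ * (F / B) * (C0 * (α x * B)) := by gcongr
      _ = κ * C0 * (α x * F) * (B⁻¹ * B) := by rw [div_eq_mul_inv]; ring
      _ = κ * C0 * (α x * F) := by rw [ENNReal.inv_mul_cancel hB0 hBt, mul_one]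
      _ ≤ κ * C0 * (G0 * ∑' a, e x a * f a) := by gcongr
      _ = κ * (G0 * C0) * ∑' a, e x a * f a := by ring
      _ ≤ 1 * ∑' a, e x a * f a := by gcongr
      _ = _ := one_mul _
  have he0 : ∀ x ∈ E, ∀ a, β a = 0 → e x a = 0 := by
    intro x hx a ha
    have := hup x hx a
    rw [ha] at this; simpa using this
  refine ⟨m + κ * (U / B), le_self_add, ENNReal.add_ne_top.2 ⟨hm, ENNReal.mul_ne_top hκt
    (ENNReal.div_ne_top hUt hB0)⟩, fun x hx => ⟨?_, ?_⟩⟩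
  · have : h1 x = m * h2 x + ∑' a, e x a * u a := by
      rw [e1 x hx, e2 x hx, ← ENNReal.tsum_mul_left, ← ENNReal.tsum_add]
      refine tsum_congr fun a => ?_
      by_cases ha : β a = 0
      · simp [he0 x hx a ha]
      · rw [← hu1 a ha]; ring
    rw [this, add_mul]
    gcongr
    exact key u x hx
  · have h3 : h1 x + ∑' a, e x a * v a = (m + w) * h2 x := by
      rw [e1 x hx, e2 x hx, ← ENNReal.tsum_mul_left, ← ENNReal.tsum_add]
      refine tsum_congr fun a => ?_
      by_cases ha : β a = 0
      · simp [he0 x hx a ha]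
      · rw [← mul_add, hv1 a ha]; ring
    have h4 := key v x hx
    have hsum : m + κ * (U / B) + θ * w + κ * (V / B) = m + w := by
      have : U / B + V / B = w := by
        rw [← ENNReal.add_div, hUV, mul_div_assoc, ENNReal.div_self hB0 hBt, mul_one]
      calc _ = m + (θ * w + κ * (U / B + V / B)) := by ring
        _ = m + (θ + κ) * w := by rw [this]; ring
        _ = _ := by rw [hκθ, one_mul]
    have hfin : κ * (V / B) * h2 x ≠ ⊤ :=
      ENNReal.mul_ne_top (ENNReal.mul_ne_top hκt (ENNReal.div_ne_top hVt hB0)) (hh2 x)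
    refine (ENNReal.add_le_add_iff_right hfin).1 ?_
    calc h1 x + κ * (V / B) * h2 x ≤ h1 x + ∑' a, e x a * v a := by gcongr
      _ = (m + w) * h2 x := h3
      _ = _ := by rw [← hsum]; ring

/-- Sublevel sets of the Gromov product with `y`. -/
def lev (S : Set Γ) (y : Γ) (t : ℝ) : Set Γ := {w | gp S 1 w y ≤ t}

lemma one_mem_lev {S : Set Γ} (hS : IsGenSet S) (y : Γ) {t : ℝ} (ht : 0 ≤ t) : (1 : Γ) ∈ lev S y t := by
  change gp S 1 1 y ≤ t
  rw [gp_eq, dd_self, dd_comm hS 1 y]; linarith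

lemma gp_lip {S : Set Γ} (hS : IsGenSet S) (y a z : Γ) : gp S 1 a y ≤ gp S 1 z y + dd S z a := by
  rw [gp_eq, gp_eq]
  have h1 := dd_tri hS a z 1
  have h2 := dd_tri hS z a y
  rw [dd_comm hS a z] at h1
  linarith

lemma domain_exists {S : Set Γ} {δ : ℝ} (hS : IsGenSet S) (hδ : IsHyperbolic S δ) {q : Ker Γ} {N : ℕ}
    {c C ρ : ℝ≥0∞} (hq : Good S q N c C ρ) :
    ∃ (L : ℕ) (G0 C0 : ℝ≥0∞), 0 < L ∧ G0 ≠ ⊤ ∧ C0 ≠ ⊤ ∧ 1 ≤ G0 ∧ 1 ≤ C0 ∧ ∀ (y : Γ) (t : ℕ), t + L ≤ wl S y →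
      ∃ (D : Set Γ) (α β : Γ → ℝ≥0∞), lev S y t ⊆ D ∧ D ⊆ lev S y (t + L) ∧
        (∀ a, β a ≠ 0 → a ∈ lev S y (t + L)) ∧
        (∀ x ∈ lev S y t, α x ≠ 0 ∧ α x ≠ ⊤) ∧
        (∀ x ∈ lev S y t, ∀ a, ent Dᶜ q x a ≤ C0 * (α x * β a)) ∧
        (∀ x ∈ lev S y t, ∀ a, α x * β a ≤ G0 * ent Dᶜ q x a) := by
  have hδ0 := hδ.1
  obtain ⟨G0, hG0, hG1, hGb⟩ := gr_bound hq
  obtain ⟨C0, hC0, hC1, hanc⟩ := ancona hS hδ hq (2 * δ)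
  obtain ⟨d, hd⟩ := exists_nat_gt (2 * δ)
  set L : ℕ := d + 2 * N + d with hL
  have hLR : (L : ℝ) = d + 2 * N + d := by rw [hL]; push_cast; ring
  have hN0 : (0 : ℝ) ≤ N := by positivity
  have hLpos : 0 < L := by
    have : (0 : ℝ) < L := by rw [hLR]; linarith
    exact_mod_cast this
  refine ⟨L, G0, C0, hLpos, hG0, hC0, hG1, hC1, fun y t ht => ?_⟩
  have htR : (t : ℝ) + L ≤ wl S y := by exact_mod_cast ht
  have ht0 : (0 : ℝ) ≤ t := by positivity
  set s : ℕ := t + d with hs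
  have hsR : (s : ℝ) = t + d := by rw [hs]; push_cast; ring
  obtain ⟨p, hp1, hp2⟩ := dd_split hS 1 y s (by rw [dd_one]; linarith)
  rw [dd_one] at hp2
  have hp1' : dd S p 1 = s := by rw [dd_comm hS]; exact hp1
  have hy1 : dd S y 1 = wl S y := dd_one' hS y
  have hpy : gp S 1 p y = s := by
    rw [gp_eq, hp1', hy1, hp2]; ring
  set D : Set Γ := {w | ∃ w0 ∈ lev S y (s + N), dd S w0 w + dd S w p = dd S w0 p} with hD
  have hsub : lev S y (s + N) ⊆ D := fun w hw => ⟨w, hw, by rw [dd_self, zero_add]⟩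
  have hsub1 : lev S y t ⊆ D := fun w hw => hsub (by
    change gp S 1 w y ≤ _
    have : gp S 1 w y ≤ t := hw
    linarith)
  have hDlev : ∀ w ∈ D, gp S 1 w y ≤ s + N + 2 * δ := by
    rintro w ⟨w0, hw0, hw⟩
    have hw0' : gp S 1 w0 y ≤ s + N := hw0
    by_contra hc
    push Not at hc
    have h1 : gp S 1 w w0 ≤ s + N + δ := by
      rcases gp_hyp hS hδ 1 w0 y w with h | h
      · rw [gp_comm hS]; linarith
      · rw [gp_comm hS] at h; linarith
    have h2 : gp S 1 w p ≤ s := by rw [← hp1']; exact gp_le_right hS 1 w p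
    have h3 : gp S 1 w y ≤ dd S w 1 := gp_le_left hS 1 w y
    have h4 : dd S w 1 = gp S 1 w0 w + gp S 1 w p - gp S 1 w0 p := by
      rw [gp_eq, gp_eq, gp_eq]; linarith
    have h5 := gp_comm hS 1 w w0
    rcases gp_hyp hS hδ 1 w0 p w with h | h
    · linarith
    · rw [gp_comm hS 1 p w] at h; linarith
  have hstar : Star S p D := by
    refine ⟨hsub (by change gp S 1 p y ≤ _; rw [hpy]; linarith), ?_⟩
    rintro w ⟨w0, hw0, hw⟩ hwp
    have hge : (1 : ℝ) ≤ dd S w p := by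
      have h0 : dd S w p ≠ 0 := fun h => hwp (dd_eq_zero hS h)
      unfold dd at h0 ⊢
      have : wdist S w p ≠ 0 := by exact_mod_cast h0
      exact_mod_cast Nat.one_le_iff_ne_zero.2 this
    obtain ⟨w', h1, h2⟩ := dd_split hS w p 1 (by push_cast; exact hge)
    push_cast at h1 h2
    refine ⟨w', ⟨w0, hw0, ?_⟩, h1.le, h2⟩
    have h3 := dd_tri hS w0 w w'
    have h4 := dd_tri hS w0 w' p
    linarith
  have hgeo : ∀ x ∈ lev S y t, ∀ z, s ≤ gp S 1 z y → gp S p x z ≤ 2 * δ := by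
    intro x hx z hz
    have hx' : gp S 1 x y ≤ t := hx
    have h2 : gp S 1 x z ≤ t + δ := by
      rcases gp_hyp hS hδ 1 x y z with h | h
      · linarith
      · rw [gp_comm hS 1 y z] at h; linarith
    have h3 : s - δ ≤ gp S 1 z p := by
      rcases gp_hyp hS hδ 1 z p y with h | h <;> linarith
    have h4 : gp S 1 x z - δ ≤ gp S 1 x p := by
      rcases gp_hyp hS hδ 1 x p z with h | h
      · linarith
      · rw [gp_comm hS 1 p z] at h; linarith
    rw [gp_eq] at h3 h4 ⊢
    rw [gp_eq] at h4
    rw [hp1'] at h3 h4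
    linarith
  refine ⟨D, fun x => gr (rs D q) x p, fun a => ent Dᶜ q p a, hsub1, ?_, ?_, ?_, ?_, ?_⟩
  · intro w hw
    have := hDlev w hw
    change gp S 1 w y ≤ _
    linarith
  · intro a ha
    have haD : a ∈ Dᶜ := by
      by_contra hc; exact ha (ent_not q p hc)
    classical
    simp only [ent, if_pos haD] at ha
    obtain ⟨z, hz⟩ : ∃ z, (if z ∈ Dᶜ then 0 else gr (rs Dᶜᶜ q) p z * q z a) ≠ 0 := by
      by_contra hc
      push Not at hc
      refine ha (ENNReal.tsum_eq_zero.2 fun z => ?_)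
      convert hc z
    have hzD : z ∈ D := by
      by_contra hc; exact hz (if_pos hc)
    rw [if_neg (by simpa using hzD)] at hz
    have h1 := hq.range z a (right_ne_zero_of_mul hz)
    have h2 := gp_lip hS y a z
    have h3 := hDlev z hzD
    change gp S 1 a y ≤ _
    linarith
  · intro x hx
    constructor
    · have := (star_lower_le hS hq hstar (wdist S x p) x (hsub1 hx) le_rfl).1
      exact fun h => pow_ne_zero _ hq.c0 (by simpa [h] using this)
    · exact ne_top_of_le_ne_top hG0 (hGb D x p)
  · intro x hx a
    by_cases ha : a ∈ Dᶜ
    · simp only [ent, if_pos ha, compl_compl]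
      rw [← ENNReal.tsum_mul_left, ← ENNReal.tsum_mul_left]
      refine ENNReal.tsum_le_tsum fun z => ?_
      by_cases hz : z ∈ Dᶜ
      · simp [if_pos hz]
      rw [if_neg hz, if_neg hz]
      by_cases hza : q z a = 0
      · simp [hza]
      have hzD : z ∈ D := by simpa using hz
      have h1 := hq.range z a hza
      have h2 : s + N < gp S 1 a y := by
        by_contra hc
        exact ha (hsub (not_lt.1 hc))
      have h3 := gp_lip hS y a z
      have h4 := hanc p D hstar x (hsub1 hx) z hzD (hgeo x hx z (by linarith))
      calc gr (rs D q) x z * q z a ≤ C0 * (gr (rs D q) x p * gr (rs D q) p z) * q z a := by gcongr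
        _ = _ := by ring
    · simp [ent_not q _ ha]
  · intro x hx a
    by_cases ha : a ∈ Dᶜ
    · simp only [ent, if_pos ha, compl_compl]
      rw [← ENNReal.tsum_mul_left, ← ENNReal.tsum_mul_left]
      refine ENNReal.tsum_le_tsum fun z => ?_
      by_cases hz : z ∈ Dᶜ
      · simp [if_pos hz]
      rw [if_neg hz, if_neg hz]
      calc gr (rs D q) x p * (gr (rs D q) p z * q z a)
          = gr (rs D q) x p * gr (rs D q) p z * q z a := by ring
        _ ≤ gr (rs D q) p p * gr (rs D q) x z * q z a := by
            gcongr ?_ * _; exact gr_mul_le_gr _ _ _ _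
        _ ≤ G0 * gr (rs D q) x z * q z a := by gcongr; exact hGb D p p
        _ = _ := by ring
    · simp [ent_not q _ ha]

/-- `h` is reproduced by the exit kernel of `D`. -/
def Rep (q : Ker Γ) (h : Γ → ℝ≥0∞) (D : Set Γ) : Prop :=
  ∀ x ∈ D, h x = ∑' a, ent Dᶜ q x a * h a

lemma contraction {S : Set Γ} {δ : ℝ} (hS : IsGenSet S) (hδ : IsHyperbolic S δ) {q : Ker Γ} {N : ℕ}
    {c C ρ : ℝ≥0∞} (hq : Good S q N c C ρ) :
    ∃ (L : ℕ) (θ H : ℝ≥0∞), 0 < L ∧ θ < 1 ∧ H ≠ ⊤ ∧ ∀ (y : Γ) (t n : ℕ) (h1 h2 : Γ → ℝ≥0∞),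
      t + (n + 1) * L ≤ wl S y → (∀ x, h1 x ≠ 0 ∧ h1 x ≠ ⊤) → (∀ x, h2 x ≠ 0 ∧ h2 x ≠ ⊤) →
      (∀ D, D ⊆ lev S y (t + (n + 1) * L) → Rep q h1 D ∧ Rep q h2 D) →
      ∃ m : ℝ≥0∞, m ≠ 0 ∧ m ≠ ⊤ ∧ ∀ x ∈ lev S y t,
        m * h2 x ≤ h1 x ∧ h1 x ≤ (m * (1 + H * θ ^ n)) * h2 x := by
  obtain ⟨L, G0, C0, hL, hG0, hC0, hG1, hC1, hdom⟩ := domain_exists hS hδ hq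
  set Z := G0 * C0 with hZ
  have hZt : Z ≠ ⊤ := ENNReal.mul_ne_top hG0 hC0
  have hZ1 : 1 ≤ Z := one_le_mul hG1 hC1
  have hZ0 : Z ≠ 0 := (zero_lt_one.trans_le hZ1).ne'
  set κ := Z⁻¹ with hκ
  have hκ1 : κ ≤ 1 := ENNReal.inv_le_one.2 hZ1
  have hκ0 : κ ≠ 0 := ENNReal.inv_ne_zero.2 hZt
  set θ := 1 - κ with hθ
  have hθκ : θ + κ = 1 := tsub_add_cancel_of_le hκ1
  refine ⟨L, θ, Z * Z, hL, ENNReal.sub_lt_self (by simp) (by simp) hκ0, ENNReal.mul_ne_top hZt hZt, ?_⟩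
  intro y t n h1 h2 hty hh1 hh2 hrep
  -- common facts at a level
  have hBfact : ∀ (k : ℕ), k ≤ n → ∃ (D : Set Γ) (α β : Γ → ℝ≥0∞),
      D ⊆ lev S y (t + (n + 1) * L) ∧ lev S y ((t + k * L : ℕ) : ℝ) ⊆ D ∧
      (∀ a, β a ≠ 0 → a ∈ lev S y ((t + (k + 1) * L : ℕ) : ℝ)) ∧
      (∀ x ∈ lev S y ((t + k * L : ℕ) : ℝ), ∀ a, ent Dᶜ q x a ≤ C0 * (α x * β a)) ∧
      (∀ x ∈ lev S y ((t + k * L : ℕ) : ℝ), ∀ a, α x * β a ≤ G0 * ent Dᶜ q x a) ∧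
      (∀ h : Γ → ℝ≥0∞, (∀ x, h x ≠ 0 ∧ h x ≠ ⊤) → Rep q h D →
        (∀ x ∈ lev S y ((t + k * L : ℕ) : ℝ), h x ≤ C0 * (α x * ∑' a, β a * h a) ∧
          α x * ∑' a, β a * h a ≤ G0 * h x) ∧
        (∑' a, β a * h a) ≠ 0 ∧ (∑' a, β a * h a) ≠ ⊤) := by
    intro k hk
    have hkn : t + k * L + L ≤ t + (n + 1) * L := by
      have : (k + 1) * L ≤ (n + 1) * L := Nat.mul_le_mul_right _ (by omega)
      rw [add_mul, one_mul] at this; omega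
    obtain ⟨D, α, β, d1, d2, d3, d4, d5, d6⟩ := hdom y (t + k * L) (hkn.trans hty)
    have hknR : ((t + k * L : ℕ) : ℝ) + L ≤ t + (n + 1) * L := by exact_mod_cast hkn
    refine ⟨D, α, β, fun x hx => le_trans (d2 hx) hknR, d1, fun a ha => ?_, d5, d6, ?_⟩
    · have := d3 a ha
      change gp S 1 a y ≤ _ at this ⊢
      push_cast at this ⊢
      linarith
    intro h hh hr
    have hb : ∀ x ∈ lev S y ((t + k * L : ℕ) : ℝ), h x ≤ C0 * (α x * ∑' a, β a * h a) ∧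
          α x * ∑' a, β a * h a ≤ G0 * h x := by
      intro x hx
      have hx' := hr x (d1 hx)
      constructor
      · rw [hx', ← ENNReal.tsum_mul_left, ← ENNReal.tsum_mul_left]
        refine ENNReal.tsum_le_tsum fun a => ?_
        calc ent Dᶜ q x a * h a ≤ C0 * (α x * β a) * h a := by gcongr; exact d5 x hx a
          _ = _ := by ring
      · rw [hx', ← ENNReal.tsum_mul_left, ← ENNReal.tsum_mul_left]
        refine ENNReal.tsum_le_tsum fun a => ?_
        calc α x * (β a * h a) = α x * β a * h a := by ring
          _ ≤ G0 * ent Dᶜ q x a * h a := by gcongr ?_ * _; exact d6 x hx a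
          _ = _ := by ring
    have h1m : (1 : Γ) ∈ lev S y ((t + k * L : ℕ) : ℝ) := one_mem_lev hS y (by positivity)
    obtain ⟨b1, b2⟩ := hb 1 h1m
    obtain ⟨a1, a2⟩ := d4 1 h1m
    refine ⟨hb, ?_, ?_⟩
    · intro h0
      rw [h0] at b1
      exact (hh 1).1 (by simpa using b1)
    · intro h0
      rw [h0, ENNReal.mul_top a1] at b2
      exact ENNReal.mul_ne_top hG0 (hh 1).2 (top_le_iff.1 b2)
  -- initial comparison
  have hinit : ∃ m : ℝ≥0∞, m ≠ 0 ∧ m ≠ ⊤ ∧ ∀ x ∈ lev S y ((t + n * L : ℕ) : ℝ),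
      m * h2 x ≤ h1 x ∧ h1 x ≤ (m + Z * Z * m) * h2 x := by
    obtain ⟨D, α, β, hDs, hsub, -, -, -, hB⟩ := hBfact n le_rfl
    obtain ⟨hr1, hr2⟩ := hrep D hDs
    obtain ⟨f1, A0, At⟩ := hB h1 hh1 hr1
    obtain ⟨f2, B0, Bt⟩ := hB h2 hh2 hr2
    set A := ∑' a, β a * h1 a
    set B := ∑' a, β a * h2 a
    refine ⟨κ * (A / B), mul_ne_zero hκ0 (ENNReal.div_ne_zero.2 ⟨A0, Bt⟩),
      ENNReal.mul_ne_top (ne_top_of_le_ne_top (by simp) hκ1) (ENNReal.div_ne_top At B0),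
      fun x hx => ⟨?_, ?_⟩⟩
    · calc κ * (A / B) * h2 x ≤ κ * (A / B) * (C0 * (α x * B)) := by gcongr; exact (f2 x hx).1
        _ = κ * C0 * (α x * A) * (B⁻¹ * B) := by rw [div_eq_mul_inv]; ring
        _ = κ * C0 * (α x * A) := by rw [ENNReal.inv_mul_cancel B0 Bt, mul_one]
        _ ≤ κ * C0 * (G0 * h1 x) := by gcongr _ * ?_; exact (f1 x hx).2
        _ = κ * Z * h1 x := by rw [hZ]; ring
        _ = h1 x := by rw [hκ, ENNReal.inv_mul_cancel hZ0 hZt, one_mul]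
    · calc h1 x ≤ C0 * (α x * A) := (f1 x hx).1
        _ = C0 * (A / B) * (α x * B) := by
          rw [div_eq_mul_inv, show C0 * (A * B⁻¹) * (α x * B) = C0 * (α x * A) * (B⁻¹ * B) by ring,
            ENNReal.inv_mul_cancel B0 Bt, mul_one]
        _ ≤ C0 * (A / B) * (G0 * h2 x) := by gcongr _ * ?_; exact (f2 x hx).2
        _ = Z * (Z * κ) * (A / B) * h2 x := by
          rw [hκ, ENNReal.mul_inv_cancel hZ0 hZt, hZ]; ring
        _ = (Z * Z * (κ * (A / B))) * h2 x := by ring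
        _ ≤ _ := by gcongr; exact le_add_self
  obtain ⟨m0, hm0, hm0t, hinit⟩ := hinit
  have hθt : θ ≠ ⊤ := ne_top_of_le_ne_top (by simp) (tsub_le_self : 1 - κ ≤ 1)
  have hiter : ∀ j : ℕ, j ≤ n → ∃ m : ℝ≥0∞, m0 ≤ m ∧ m ≠ ⊤ ∧
      ∀ x ∈ lev S y ((t + (n - j) * L : ℕ) : ℝ),
      m * h2 x ≤ h1 x ∧ h1 x ≤ (m + θ ^ j * (Z * Z * m0)) * h2 x := by
    intro j
    induction j with
    | zero =>
      intro _
      exact ⟨m0, le_rfl, hm0t, by simpa using hinit⟩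
    | succ j ih =>
      intro hj
      obtain ⟨m, hm1, hm2, hm3⟩ := ih (by omega)
      obtain ⟨D, α, β, hDs, hsub, hβ, hup, hlo, hB⟩ := hBfact (n - (j + 1)) (by omega)
      obtain ⟨hr1, hr2⟩ := hrep D hDs
      obtain ⟨f2, B0, Bt⟩ := hB h2 hh2 hr2
      have hidx : n - (j + 1) + 1 = n - j := by omega
      rw [hidx] at hβ
      obtain ⟨m', k1, k2, k3⟩ := contract_step (lev S y ((t + (n - (j + 1)) * L : ℕ) : ℝ)) (ent Dᶜ q) α β h1 h2 κ θ
        m (θ ^ j * (Z * Z * m0)) hθκ hm2 (ENNReal.mul_ne_top (ENNReal.pow_ne_top hθt)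
          (ENNReal.mul_ne_top (ENNReal.mul_ne_top hZt hZt) hm0t)) _ rfl B0 Bt (fun a => (hh2 a).2) G0 C0
        (by rw [hκ, ← hZ, ENNReal.inv_mul_cancel hZ0 hZt])
        (fun x hx => hr1 x (hsub hx)) (fun x hx => hr2 x (hsub hx)) hup hlo
        (fun a ha => hm3 a (hβ a ha))
      refine ⟨m', hm1.trans k1, k2, fun x hx => ⟨(k3 x hx).1, (k3 x hx).2.trans (le_of_eq ?_)⟩⟩
      rw [pow_succ]; ring
  obtain ⟨m, hm1, hm2, hm3⟩ := hiter n le_rfl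
  refine ⟨m, (lt_of_lt_of_le (pos_iff_ne_zero.2 hm0) hm1).ne', hm2, fun x hx => ?_⟩
  have := hm3 x (by simpa using hx)
  refine ⟨this.1, this.2.trans ?_⟩
  calc (m + θ ^ n * (Z * Z * m0)) * h2 x ≤ (m + θ ^ n * (Z * Z * m)) * h2 x := by gcongr
    _ = _ := by ring

/-! ### Nonamenability -/

lemma drift_exp (S : Set Γ) {ι : Type} (T : Finset ι) (a : ι → Γ) (n : ℕ) (hn : 1 ≤ n)
    (hT : ∀ x, ∀ i ∈ T, |(wl S (x * a i) : ℝ) - wl S x| ≤ n)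
    (hd : ∀ x : Γ, (T.card : ℝ) ≤ ∑ i ∈ T, ((wl S (x * a i) : ℝ) - wl S x)) :
    ∃ ε l : ℝ, 0 < ε ∧ 0 < l ∧ l < 1 ∧ ∀ x : Γ,
      ∑ i ∈ T, Real.exp (-ε * wl S (x * a i)) ≤ l * T.card * Real.exp (-ε * wl S x) := by
  have hn1 : (1 : ℝ) ≤ n := by exact_mod_cast hn
  have hn2 : (1 : ℝ) ≤ (n : ℝ) ^ 2 := by nlinarith
  set ε : ℝ := 1 / (2 * n ^ 2) with hε
  have hε0 : 0 < ε := by positivity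
  have hεn2 : ε * n ^ 2 = 1 / 2 := by rw [hε]; field_simp
  have hε1 : ε ≤ 1 / 2 := by nlinarith
  have hεn : ε * n ≤ 1 := by nlinarith
  refine ⟨ε, 1 - ε / 2, hε0, by linarith, by linarith, fun x => ?_⟩
  have hterm : ∀ i ∈ T, Real.exp (-ε * wl S (x * a i)) ≤
      (1 - ε * ((wl S (x * a i) : ℝ) - wl S x) + ε / 2) * Real.exp (-ε * wl S x) := by
    intro i hi
    set d := (wl S (x * a i) : ℝ) - wl S x with hd
    have hdn : |d| ≤ n := hT x i hi
    have h1 : |-ε * d| ≤ 1 := by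
      rw [abs_mul, abs_neg, abs_of_pos hε0]
      exact (mul_le_mul_of_nonneg_left hdn hε0.le).trans hεn
    have h2 := Real.abs_exp_sub_one_sub_id_le h1
    have h3 := (abs_le.1 h2).2
    have h4 : (-ε * d) ^ 2 ≤ ε / 2 := by
      have : d ^ 2 ≤ (n : ℝ) ^ 2 := sq_le_sq' (by linarith [(abs_le.1 hdn).1]) (abs_le.1 hdn).2
      calc (-ε * d) ^ 2 = ε * (ε * d ^ 2) := by ring
        _ ≤ ε * (ε * n ^ 2) := by gcongr
        _ = ε / 2 := by rw [hεn2]; ring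
    have h5 : Real.exp (-ε * wl S (x * a i)) = Real.exp (-ε * d) * Real.exp (-ε * wl S x) := by
      rw [← Real.exp_add]; congr 1; rw [hd]; ring
    rw [h5]
    gcongr
    linarith
  refine (Finset.sum_le_sum hterm).trans ?_
  rw [← Finset.sum_mul]
  gcongr
  rw [Finset.sum_add_distrib, Finset.sum_sub_distrib, ← Finset.mul_sum]
  simp only [Finset.sum_const, nsmul_eq_mul, mul_one]
  have := mul_le_mul_of_nonneg_left (hd x) hε0.le
  linarith

lemma wl_mul_gp {S : Set Γ} (hS : IsGenSet S) (x a : Γ) :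
    (wl S (x * a) : ℝ) - wl S x = wl S a - 2 * gp S 1 x⁻¹ a := by
  have : dd S x⁻¹ a = wl S (x * a) := by simp [dd, wdist]
  rw [gp_eq, dd_one' hS, dd_one' hS, this, wl_inv hS]; ring

lemma wl_mul_abs {S : Set Γ} (hS : IsGenSet S) (x a : Γ) :
    |(wl S (x * a) : ℝ) - wl S x| ≤ wl S a := by
  have h1 : (wl S (x * a) : ℝ) ≤ wl S x + wl S a := by exact_mod_cast wl_mul hS x a
  have h2 : (wl S x : ℝ) ≤ wl S (x * a) + wl S a := by
    have := wl_mul hS (x * a) a⁻¹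
    rw [mul_inv_cancel_right, wl_inv hS] at this
    exact_mod_cast this
  rw [abs_le]; constructor <;> linarith

lemma sum_exp_top {S : Set Γ} {δ : ℝ} (hS : IsGenSet S) (hδ : IsHyperbolic S δ)
    (hne : Nonelementary Γ) :
    ∃ ε : ℝ, 0 < ε ∧ ∑' x : Γ, ENNReal.ofReal (Real.exp (-ε * wl S x)) = ⊤ := by
  have hδ0 := hδ.1
  obtain ⟨k, hk, htri⟩ := exists_tripod hS hδ hne
  obtain ⟨n, hn⟩ := exists_nat_gt (4 * (k + δ) + 3)
  obtain ⟨a, ha1, ha2⟩ := htri n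
  have hn1 : 1 ≤ n := by
    have : (0 : ℝ) < n := by linarith
    exact_mod_cast this
  obtain ⟨ε, l, hε, hl0, hl1, hmain⟩ := drift_exp S (Finset.univ : Finset (Fin 3)) a n hn1
    (fun x i _ => by rw [← ha1 i]; exact wl_mul_abs hS x (a i)) (by
      intro x
      simp only [wl_mul_gp hS, ha1]
      have hle : ∀ i, gp S 1 x⁻¹ (a i) ≤ n := by
        intro i
        have := gp_le_right hS 1 x⁻¹ (a i)
        rwa [dd_one' hS, ha1] at this
      have hpair : ∀ i j, i ≠ j → gp S 1 x⁻¹ (a i) ≤ k + δ ∨ gp S 1 x⁻¹ (a j) ≤ k + δ := by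
        intro i j hij
        have h0 := ha2 i j hij
        rcases gp_hyp hS hδ 1 (a i) (a j) x⁻¹ with h | h
        · left; rw [gp_comm hS]; linarith
        · right; rw [gp_comm hS]; linarith
      rw [Fin.sum_univ_three]
      simp only [Finset.card_univ, Fintype.card_fin]
      have h0 := hle 0
      have h1 := hle 1
      have h2 := hle 2
      push_cast
      rcases hpair 0 1 (by decide) with h01 | h01 <;> rcases hpair 0 2 (by decide) with h02 | h02 <;>
        rcases hpair 1 2 (by decide) with h12 | h12 <;> linarith)
  refine ⟨ε, hε, ?_⟩
  by_contra hc
  set φ : Γ → ℝ≥0∞ := fun x => ENNReal.ofReal (Real.exp (-ε * wl S x)) with hφ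
  have hφ1 : (1 : ℝ≥0∞) ≤ ∑' x, φ x := by
    refine le_trans ?_ (ENNReal.le_tsum 1)
    simp [hφ, wl_one]
  have hsh : ∀ i, ∑' x, φ (x * a i) = ∑' x, φ x := fun i => (Equiv.mulRight (a i)).tsum_eq φ
  have h1 : ∀ x, ∑ i, φ (x * a i) ≤ ENNReal.ofReal (l * 3) * φ x := by
    intro x
    have := hmain x
    simp only [Finset.card_univ, Fintype.card_fin] at this
    rw [hφ, ← ENNReal.ofReal_sum_of_nonneg (fun i _ => (Real.exp_pos _).le),
      ← ENNReal.ofReal_mul (by positivity)]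
    exact ENNReal.ofReal_le_ofReal (by exact_mod_cast this)
  have h2 : ∑' x, ∑ i, φ (x * a i) = 3 * ∑' x, φ x := by
    simp only [Fin.sum_univ_three, ENNReal.tsum_add, hsh]; ring
  have h3 : 3 * ∑' x, φ x ≤ ENNReal.ofReal (l * 3) * ∑' x, φ x := by
    rw [← h2, ← ENNReal.tsum_mul_left]
    exact ENNReal.tsum_le_tsum h1
  have h4 : (3 : ℝ≥0∞) ≤ ENNReal.ofReal (l * 3) :=
    (ENNReal.mul_le_mul_iff_left (zero_lt_one.trans_le hφ1).ne' hc).1 h3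
  have h5 : (3 : ℝ) ≤ l * 3 := by
    have h4' : ENNReal.ofReal 3 ≤ ENNReal.ofReal (l * 3) := by
      rw [show ENNReal.ofReal 3 = 3 by norm_num]; exact h4
    exact (ENNReal.ofReal_le_ofReal_iff (by positivity)).1 h4'
  linarith

/-- balls as finsets -/
noncomputable def bl {S : Set Γ} (hS : IsGenSet S) (n : ℕ) : Finset Γ := (ball_finite hS n).toFinset

lemma mem_bl {S : Set Γ} (hS : IsGenSet S) (n : ℕ) (g : Γ) : g ∈ bl hS n ↔ wl S g ≤ n := by
  simp [bl]

lemma growth {S : Set Γ} (hS : IsGenSet S) {ε : ℝ} (hε : 0 < ε)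
    (htop : ∑' x : Γ, ENNReal.ofReal (Real.exp (-ε * wl S x)) = ⊤) (k : ℕ) (hk : 1 ≤ k)
    (hk10 : 10 * Real.exp (-ε * k) < 1) (n0 : ℕ) :
    ∃ m, n0 ≤ m ∧ 10 * (bl hS m).card ≤ (bl hS (m + k)).card := by
  classical
  by_contra hc
  push Not at hc
  have hb : ∀ j : ℕ, (bl hS (n0 + j * k)).card ≤ 10 ^ j * (bl hS n0).card := by
    intro j
    induction j with
    | zero => simp
    | succ j ih =>
      have := hc (n0 + j * k) (by omega)
      rw [show n0 + (j + 1) * k = n0 + j * k + k by ring, pow_succ]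
      calc _ ≤ 10 * (bl hS (n0 + j * k)).card := this.le
        _ ≤ 10 * (10 ^ j * (bl hS n0).card) := by gcongr
        _ = _ := by ring
  have hpt : ∀ x : Γ, ENNReal.ofReal (Real.exp (-ε * wl S x)) ≤
      ∑' j : ℕ, (if x ∈ bl hS (n0 + j * k) then ENNReal.ofReal (Real.exp (ε * k) * Real.exp (-ε * k) ^ j) else 0) := by
    intro x
    set j := wl S x / k + 1 with hj
    have h1 : wl S x ≤ j * k := by
      have := Nat.lt_mul_div_succ (wl S x) (show 0 < k by omega)
      rw [hj, mul_comm]; exact this.le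
    have h2 : (wl S x / k) * k ≤ wl S x := Nat.div_mul_le_self _ _
    refine le_trans ?_ (ENNReal.le_tsum j)
    rw [if_pos ((mem_bl hS _ _).2 (by omega))]
    apply ENNReal.ofReal_le_ofReal
    rw [← Real.exp_nat_mul, ← Real.exp_add]
    apply Real.exp_le_exp.2
    have h2' : ((wl S x / k : ℕ) : ℝ) * k ≤ wl S x := by exact_mod_cast h2
    have h3 : (j : ℝ) = ((wl S x / k : ℕ) : ℝ) + 1 := by rw [hj]; push_cast; ring
    rw [h3]
    nlinarith
  have hle := ENNReal.tsum_le_tsum hpt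
  rw [htop, ENNReal.tsum_comm] at hle
  have hinner : ∀ j : ℕ, ∑' x : Γ, (if x ∈ bl hS (n0 + j * k) then
      ENNReal.ofReal (Real.exp (ε * k) * Real.exp (-ε * k) ^ j) else 0) ≤
      ENNReal.ofReal (Real.exp (ε * k) * (bl hS n0).card) * ENNReal.ofReal (10 * Real.exp (-ε * k)) ^ j := by
    intro j
    rw [tsum_eq_sum (s := bl hS (n0 + j * k)) (fun x hx => if_neg hx),
      Finset.sum_congr rfl (fun x hx => if_pos hx), Finset.sum_const, nsmul_eq_mul,
      ← ENNReal.ofReal_natCast, ← ENNReal.ofReal_mul (by positivity), ← ENNReal.ofReal_pow (by positivity),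
      ← ENNReal.ofReal_mul (by positivity)]
    apply ENNReal.ofReal_le_ofReal
    have : ((bl hS (n0 + j * k)).card : ℝ) ≤ 10 ^ j * (bl hS n0).card := by exact_mod_cast hb j
    calc _ ≤ (10 ^ j * (bl hS n0).card : ℝ) * (Real.exp (ε * k) * Real.exp (-ε * k) ^ j) := by gcongr
      _ = _ := by rw [mul_pow]; ring
  have hle2 := hle.trans (ENNReal.tsum_le_tsum hinner)
  rw [ENNReal.tsum_mul_left, ENNReal.tsum_geometric] at hle2
  have hlt : ENNReal.ofReal (10 * Real.exp (-ε * k)) < 1 := by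
    rw [← ENNReal.ofReal_one]
    exact (ENNReal.ofReal_lt_ofReal_iff (by norm_num)).2 hk10
  exact ENNReal.mul_ne_top ENNReal.ofReal_ne_top (ENNReal.inv_ne_top.2 (tsub_pos_of_lt hlt).ne')
    (top_le_iff.1 hle2)

lemma ball_drift {S : Set Γ} {δ : ℝ} (hS : IsGenSet S) (hδ : IsHyperbolic S δ)
    (hne : Nonelementary Γ) :
    ∃ (n : ℕ) (ε l : ℝ), 1 ≤ n ∧ 0 < ε ∧ 0 < l ∧ l < 1 ∧ ∀ x : Γ,
      ∑ g ∈ bl hS n, Real.exp (-ε * wl S (x * g)) ≤ l * (bl hS n).card * Real.exp (-ε * wl S x) := by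
  classical
  have hδ0 := hδ.1
  obtain ⟨ε, hε, htop⟩ := sum_exp_top hS hδ hne
  obtain ⟨k, hk, hk1⟩ : ∃ k : ℕ, 10 * Real.exp (-ε * k) < 1 ∧ 1 ≤ k := by
    have h1 : Tendsto (fun k : ℕ => 10 * Real.exp (-ε * k)) atTop (𝓝 (10 * 0)) := by
      apply Tendsto.const_mul
      apply Real.tendsto_exp_atBot.comp
      exact (tendsto_natCast_atTop_atTop).const_mul_atTop_of_neg (by linarith)
    rw [mul_zero] at h1
    exact ((h1.eventually_lt_const one_pos).and (eventually_ge_atTop 1)).exists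
  obtain ⟨k', hk'⟩ := exists_nat_gt (k + 2 * δ)
  obtain ⟨m, hm, hgr⟩ := growth hS hε htop k hk1 hk (2 * (k + 2 * k' + 1))
  set n := m + k with hn
  have hmR : (2 * (k + 2 * k' + 1) : ℝ) ≤ m := by exact_mod_cast hm
  have hnR : (n : ℝ) = m + k := by rw [hn]; push_cast; ring
  have hk0 : (0 : ℝ) ≤ k := by positivity
  obtain ⟨ε', l, h1, h2, h3, h4⟩ := drift_exp S (bl hS n) id n (by omega)
    (fun x g hg => (wl_mul_abs hS x g).trans (by exact_mod_cast (mem_bl hS n g).1 hg)) (by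
    intro x
    simp only [id]
    set bad1 := (bl hS n).filter (fun g => wl S g ≤ m) with hbad1
    set bad2 := (bl hS n).filter (fun g => (k' : ℝ) < gp S 1 x⁻¹ g) with hbad2
    have c1 : bad1.card ≤ (bl hS m).card := Finset.card_le_card (by
      intro g hg
      rw [hbad1, Finset.mem_filter] at hg
      exact (mem_bl hS m g).2 hg.2)
    have c2 : bad2.card ≤ (bl hS m).card := by
      by_cases hx : (k' : ℝ) ≤ wl S x⁻¹
      · obtain ⟨p, hp1, hp2⟩ := dd_split hS 1 x⁻¹ k' (by rw [dd_one]; exact hx)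
        apply Finset.card_le_card_of_injOn (fun g => p⁻¹ * g)
        · intro g hg
          rw [Finset.mem_coe, hbad2, Finset.mem_filter] at hg
          rw [Finset.mem_coe, mem_bl]
          have hgn : (wl S g : ℝ) ≤ n := by exact_mod_cast (mem_bl hS n g).1 hg.1
          have hg2 := hg.2
          have hpx : gp S 1 p x⁻¹ = k' := by
            rw [gp_eq, dd_comm hS p 1, hp1, hp2, dd_comm hS x⁻¹ 1]; ring
          have hpg : k' - δ ≤ gp S 1 p g := by
            rcases gp_hyp hS hδ 1 p g x⁻¹ with h | h
            · linarith
            · rw [gp_comm hS 1 g x⁻¹] at h; linarith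
          rw [gp_eq, dd_comm hS p 1, hp1, dd_one' hS] at hpg
          have : dd S p g = wl S (p⁻¹ * g) := rfl
          rw [this] at hpg
          have : (wl S (p⁻¹ * g) : ℝ) ≤ m := by linarith
          exact_mod_cast this
        · intro g _ g' _ h
          simpa using h
      · have : bad2 = ∅ := by
          rw [hbad2, Finset.filter_eq_empty_iff]
          intro g _ h
          have h2 := gp_le_left hS 1 x⁻¹ g
          rw [dd_one' hS] at h2
          linarith
        rw [this]; simp
    have hpt : ∀ g ∈ bl hS n, ((n : ℝ) - k - 2 * k') - (if wl S g ≤ m then 2 * (n : ℝ) else 0)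
        - (if (k' : ℝ) < gp S 1 x⁻¹ g then 2 * (n : ℝ) else 0) ≤ (wl S (x * g) : ℝ) - wl S x := by
      intro g hg
      have hgn : (wl S g : ℝ) ≤ n := by exact_mod_cast (mem_bl hS n g).1 hg
      have hab := (abs_le.1 (wl_mul_abs hS x g)).1
      have hk'0 : (0 : ℝ) ≤ k' := by positivity
      have hm0 : (0 : ℝ) ≤ m := by positivity
      by_cases b1 : wl S g ≤ m
      · rw [if_pos b1]
        split_ifs <;> linarith
      · rw [if_neg b1]
        by_cases b2 : (k' : ℝ) < gp S 1 x⁻¹ g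
        · rw [if_pos b2]; linarith
        · rw [if_neg b2, wl_mul_gp hS]
          have : (m : ℝ) ≤ wl S g := by exact_mod_cast (not_le.1 b1).le
          linarith
    refine le_trans ?_ (Finset.sum_le_sum hpt)
    rw [Finset.sum_sub_distrib, Finset.sum_sub_distrib, ← Finset.sum_filter, ← Finset.sum_filter]
    simp only [Finset.sum_const, nsmul_eq_mul]
    rw [← hbad1, ← hbad2]
    have hgrR : 10 * ((bl hS m).card : ℝ) ≤ (bl hS n).card := by exact_mod_cast hgr
    have c1R : (bad1.card : ℝ) ≤ (bl hS m).card := by exact_mod_cast c1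
    have c2R : (bad2.card : ℝ) ≤ (bl hS m).card := by exact_mod_cast c2
    have hn0 : (0 : ℝ) ≤ n := by positivity
    have hb0 : (0 : ℝ) ≤ (bl hS n).card := by positivity
    have e1 : (bad1.card : ℝ) * (2 * n) + (bad2.card : ℝ) * (2 * n) ≤ ((bl hS n).card : ℝ) * (4 / 10 * n) := by
      nlinarith
    have e2 : ((bl hS n).card : ℝ) * 1 ≤ (bl hS n).card * (n - k - 2 * k' - 4 / 10 * n) := by
      gcongr; linarith
    linarith)
  exact ⟨n, ε', l, by omega, h1, h2, h3, h4⟩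

/-! ### Decay of transition probabilities -/

lemma two_mul_le_sq (a b : ℝ≥0∞) : 2 * (a * b) ≤ a ^ 2 + b ^ 2 := by
  have key : ∀ a b : ℝ≥0∞, a ≤ b → 2 * (a * b) ≤ a ^ 2 + b ^ 2 := by
    intro a b h
    obtain ⟨d, rfl⟩ := exists_add_of_le h
    calc 2 * (a * (a + d)) ≤ 2 * (a * (a + d)) + d ^ 2 := le_self_add
      _ = _ := by ring
  rcases le_total a b with h | h
  · exact key a b h
  · have := key b a h
    rwa [mul_comm b a, add_comm] at this

lemma jensen {X : Type} (b α : X → ℝ≥0∞) :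
    (∑' x, b x * α x) ^ 2 ≤ (∑' x, b x) * ∑' x, b x * α x ^ 2 := by
  have h2 : 2 * (∑' x, b x * α x) ^ 2 ≤ 2 * ((∑' x, b x) * ∑' x, b x * α x ^ 2) := by
    have e1 : (∑' x, b x * α x) ^ 2 = ∑' x, ∑' y, (b x * α x) * (b y * α y) := by
      simp only [ENNReal.tsum_mul_left, ENNReal.tsum_mul_right, sq]
    have e2 : (∑' x, b x) * (∑' x, b x * α x ^ 2) = ∑' x, ∑' y, b x * (b y * α y ^ 2) := by
      simp only [ENNReal.tsum_mul_left, ENNReal.tsum_mul_right]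
    have e3 : (∑' x, b x) * (∑' x, b x * α x ^ 2) = ∑' x, ∑' y, b y * (b x * α x ^ 2) := by
      rw [e2, ENNReal.tsum_comm]
    rw [two_mul (_ * _)]
    nth_rw 1 [e2]
    rw [e3, e1, ← ENNReal.tsum_add, ← ENNReal.tsum_mul_left]
    refine ENNReal.tsum_le_tsum fun x => ?_
    rw [← ENNReal.tsum_add, ← ENNReal.tsum_mul_left]
    refine ENNReal.tsum_le_tsum fun y => ?_
    calc 2 * ((b x * α x) * (b y * α y)) = b x * b y * (2 * (α x * α y)) := by ring
      _ ≤ b x * b y * (α x ^ 2 + α y ^ 2) := by gcongr; exact two_mul_le_sq _ _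
      _ = _ := by ring
  exact (ENNReal.mul_le_mul_iff_right (by simp) (by simp)).1 h2

lemma schur {X : Type} (a : Ker X) (w : X → ℝ≥0∞) (hw : ∀ x, w x ≠ 0 ∧ w x ≠ ⊤) (A B : ℝ≥0∞)
    (hr : ∀ x, ∑' y, a x y * w y ≤ A * w x) (hc : ∀ y, ∑' x, a x y * w x ≤ B * w y)
    (f : X → ℝ≥0∞) : ∑' y, (∑' x, f x * a x y) ^ 2 ≤ A * B * ∑' x, f x ^ 2 := by
  have hww : ∀ x, w x * (w x)⁻¹ = 1 := fun x => ENNReal.mul_inv_cancel (hw x).1 (hw x).2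
  have h1 : ∀ y, (∑' x, f x * a x y) ^ 2 ≤ B * ∑' x, a x y * w y * (f x ^ 2 * (w x)⁻¹) := by
    intro y
    have := jensen (fun x => a x y * w x) (fun x => f x * (w x)⁻¹)
    calc (∑' x, f x * a x y) ^ 2 = (∑' x, a x y * w x * (f x * (w x)⁻¹)) ^ 2 := by
          congr 1; refine tsum_congr fun x => ?_
          calc f x * a x y = f x * a x y * (w x * (w x)⁻¹) := by rw [hww, mul_one]
            _ = _ := by ring
      _ ≤ _ := this
      _ ≤ (B * w y) * ∑' x, a x y * w x * (f x * (w x)⁻¹) ^ 2 := by gcongr; exact hc y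
      _ = _ := by
          rw [mul_assoc, ← ENNReal.tsum_mul_left]
          congr 1; refine tsum_congr fun x => ?_
          calc _ = (w x * (w x)⁻¹) * (a x y * w y * (f x ^ 2 * (w x)⁻¹)) := by ring
            _ = _ := by rw [hww, one_mul]
  calc _ ≤ ∑' y, B * ∑' x, a x y * w y * (f x ^ 2 * (w x)⁻¹) := ENNReal.tsum_le_tsum h1
    _ = B * ∑' x, (∑' y, a x y * w y) * (f x ^ 2 * (w x)⁻¹) := by
        rw [ENNReal.tsum_mul_left, ENNReal.tsum_comm]; simp only [ENNReal.tsum_mul_right]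
    _ ≤ B * ∑' x, A * f x ^ 2 := by
        gcongr _ * ?_
        refine ENNReal.tsum_le_tsum fun x => ?_
        calc _ ≤ (A * w x) * (f x ^ 2 * (w x)⁻¹) := by gcongr; exact hr x
          _ = (w x * (w x)⁻¹) * (A * f x ^ 2) := by ring
          _ = _ := by rw [hww, one_mul]
    _ = _ := by rw [ENNReal.tsum_mul_left]; ring

lemma row_pow {X : Type} (q : Ker X) (hq : ∀ x, ∑' y, q x y = 1) (n : ℕ) (x : X) :
    ∑' y, (q ^ n) x y = 1 := by
  induction n generalizing x with
  | zero => rw [pow_zero, tsum_eq_single x (fun y hy => one_ne hy.symm), one_self]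
  | succ n ih =>
    rw [pow_succ]; simp only [mul_apply]
    rw [ENNReal.tsum_comm]
    simp only [ENNReal.tsum_mul_left, hq, mul_one, ih]

lemma col_pow {X : Type} (q : Ker X) (hq : ∀ y, ∑' x, q x y = 1) (n : ℕ) (y : X) :
    ∑' x, (q ^ n) x y = 1 := by
  have := row_pow (kt q) hq n y
  rw [← kt_pow] at this
  exact this

open Classical in
lemma norm_contract (T : Finset Γ) (hT1 : 1 ∈ T) (hTi : ∀ g ∈ T, g⁻¹ ∈ T) (κ : Ker Γ)
    (hr : ∀ x, ∑' y, κ x y = 1) (hc : ∀ y, ∑' x, κ x y = 1) (c : ℝ≥0∞) (hc0 : c ≠ 0)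
    (hlow : ∀ x y, x⁻¹ * y ∈ T → c ≤ κ x y) (w : Γ → ℝ≥0∞) (hw : ∀ x, w x ≠ 0 ∧ w x ≠ ⊤)
    (l : ℝ≥0∞) (hl : l < 1) (hdr : ∀ x, ∑ g ∈ T, w (x * g) ≤ l * T.card * w x) :
    ∃ Θ : ℝ≥0∞, Θ < 1 ∧ ∀ f : Γ → ℝ≥0∞,
      ∑' y, (∑' x, f x * κ x y) ^ 2 ≤ Θ * ∑' x, f x ^ 2 := by
  set n : ℝ≥0∞ := (T.card : ℝ≥0∞) with hn
  have hn0 : n ≠ 0 := by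
    rw [hn]; exact_mod_cast (Finset.card_pos.2 ⟨1, hT1⟩).ne'
  have hnt : n ≠ ⊤ := by simp [hn]
  have hnn : n * n⁻¹ = 1 := ENNReal.mul_inv_cancel hn0 hnt
  set Tn : Ker Γ := fun x y => if x⁻¹ * y ∈ T then n⁻¹ else 0 with hTn
  have hsum : ∀ (u : Γ → ℝ≥0∞) x, ∑' y, Tn x y * u y = n⁻¹ * ∑ g ∈ T, u (x * g) := by
    intro u x
    rw [← (Equiv.mulLeft x).tsum_eq, tsum_eq_sum (s := T), Finset.mul_sum]
    · refine Finset.sum_congr rfl fun g hg => ?_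
      simp [hTn, hg]
    · intro g hg; simp [hTn, hg]
  have hsymm : ∀ x y, Tn x y = Tn y x := by
    intro x y
    have : x⁻¹ * y ∈ T ↔ y⁻¹ * x ∈ T := by
      constructor
      · intro h; simpa using hTi _ h
      · intro h; simpa using hTi _ h
    simp only [hTn, this]
  have hrow1 : ∀ x, ∑' y, Tn x y = 1 := by
    intro x
    have := hsum (fun _ => 1) x
    simp only [mul_one, Finset.sum_const, nsmul_eq_mul] at this
    rw [this, mul_comm]; exact hnn
  have hroww : ∀ x, ∑' y, Tn x y * w y ≤ l * w x := by
    intro x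
    rw [hsum]
    calc _ ≤ n⁻¹ * (l * n * w x) := by gcongr; exact hdr x
      _ = (n * n⁻¹) * (l * w x) := by ring
      _ = _ := by rw [hnn, one_mul]
  have hcn : c * n ≤ 1 := by
    rw [← hr 1]
    calc c * n = ∑' y, c * n * Tn 1 y := by rw [ENNReal.tsum_mul_left, hrow1, mul_one]
      _ ≤ _ := by
        refine ENNReal.tsum_le_tsum fun y => ?_
        by_cases h : (1:Γ)⁻¹ * y ∈ T
        · simp only [hTn, if_pos h]
          rw [mul_assoc, hnn, mul_one]; exact hlow _ _ h
        · simp [hTn, if_neg h]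
  set t : ℝ≥0∞ := c * n / 2 with ht
  have ht12 : t ≤ 1 / 2 := by rw [ht]; gcongr
  have ht0 : t ≠ 0 := by
    rw [ht]; simp [hc0, hn0, ENNReal.div_eq_zero_iff]
  have htt : t ≠ ⊤ := ne_top_of_le_ne_top (by simp) ht12
  have ht1 : t < 1 := ht12.trans_lt (by simp)
  set r : ℝ≥0∞ := 1 - t with hrr
  have htr : t + r = 1 := add_tsub_cancel_of_le ht1.le
  have hr0 : r ≠ 0 := (tsub_pos_of_lt ht1).ne'
  have hrt : r ≠ ⊤ := ne_top_of_le_ne_top (by simp) (tsub_le_self : 1 - t ≤ 1)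
  have hri : r * r⁻¹ = 1 := ENNReal.mul_inv_cancel hr0 hrt
  have hle : ∀ x y, t * Tn x y ≤ κ x y := by
    intro x y
    by_cases h : x⁻¹ * y ∈ T
    · simp only [hTn, if_pos h]
      calc t * n⁻¹ ≤ c * n * n⁻¹ := by gcongr; exact ENNReal.half_le_self
        _ = c := by rw [mul_assoc, hnn, mul_one]
        _ ≤ _ := hlow _ _ h
    · simp [hTn, if_neg h]
  set s : Ker Γ := fun x y => r⁻¹ * (κ x y - t * Tn x y) with hs
  have hκ : ∀ x y, κ x y = t * Tn x y + r * s x y := by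
    intro x y
    simp only [hs]
    rw [← mul_assoc, hri, one_mul, add_tsub_cancel_of_le (hle x y)]
  have cancel : ∀ z : ℝ≥0∞, t + r * z = 1 → z = 1 := by
    intro z h
    rw [← htr] at h
    have h' := (ENNReal.add_right_inj htt).1 h
    calc z = (r * r⁻¹) * z := by rw [hri, one_mul]
      _ = (r * z) * r⁻¹ := by ring
      _ = 1 := by rw [h', hri]
  have hs1 : ∀ x, ∑' y, s x y = 1 := by
    intro x
    apply cancel
    have := hr x
    simp only [hκ x, ENNReal.tsum_add, ENNReal.tsum_mul_left, hrow1, mul_one] at this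
    exact this
  have hs2 : ∀ y, ∑' x, s x y = 1 := by
    intro y
    apply cancel
    have := hc y
    simp only [hκ _ y, ENNReal.tsum_add, ENNReal.tsum_mul_left, hsymm _ y, hrow1, mul_one] at this
    exact this
  refine ⟨t * (l * l) + r, ?_, fun f => ?_⟩
  · rw [← htr]
    refine ENNReal.add_lt_add_right hrt ?_
    calc t * (l * l) < t * 1 := by
          refine (ENNReal.mul_lt_mul_iff_right ht0 htt).2 ?_
          exact mul_lt_one_of_nonneg_of_lt_one_left (by simp) hl hl.le
      _ = t := mul_one t
  have h1 := schur Tn w hw l l hroww (fun y => by simp only [hsymm _ y]; exact hroww y) f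
  have h2 := schur s (fun _ => 1) (fun _ => by simp) 1 1 (fun x => by simp [hs1]) (fun x => by simp [hs2]) f
  calc ∑' y, (∑' x, f x * κ x y) ^ 2
      = ∑' y, (t * (∑' x, f x * Tn x y) + r * ∑' x, f x * s x y) ^ 2 := by
        refine tsum_congr fun y => ?_
        rw [← ENNReal.tsum_mul_left, ← ENNReal.tsum_mul_left, ← ENNReal.tsum_add]
        congr 1; refine tsum_congr fun x => ?_
        rw [hκ]; ring
    _ ≤ ∑' y, (t * (∑' x, f x * Tn x y) ^ 2 + r * (∑' x, f x * s x y) ^ 2) := by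
        refine ENNReal.tsum_le_tsum fun y => ?_
        generalize (∑' x, f x * Tn x y) = α
        generalize (∑' x, f x * s x y) = β
        calc (t * α + r * β) ^ 2 = t ^ 2 * α ^ 2 + r ^ 2 * β ^ 2 + t * r * (2 * (α * β)) := by ring
          _ ≤ t ^ 2 * α ^ 2 + r ^ 2 * β ^ 2 + t * r * (α ^ 2 + β ^ 2) := by
            gcongr; exact two_mul_le_sq _ _
          _ = (t + r) * (t * α ^ 2 + r * β ^ 2) := by ring
          _ = _ := by rw [htr, one_mul]
    _ ≤ t * (l * l * ∑' x, f x ^ 2) + r * (1 * 1 * ∑' x, f x ^ 2) := by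
        rw [ENNReal.tsum_add, ENNReal.tsum_mul_left, ENNReal.tsum_mul_left]
        gcongr
    _ = _ := by ring

lemma le_of_sq {a b : ℝ≥0∞} (h : a ^ 2 ≤ b ^ 2) : a ≤ b := by
  by_contra hc
  exact absurd h (not_le.2 (ENNReal.pow_lt_pow_left (by norm_num) (not_le.1 hc)))

lemma decay_of {X : Type} (q : Ker X) (hc : ∀ y, ∑' x, q x y = 1) (M : ℕ) (hM : 1 ≤ M)
    (Θ : ℝ≥0∞) (hΘ : Θ < 1)
    (h : ∀ f : X → ℝ≥0∞, ∑' y, (∑' x, f x * (q ^ M) x y) ^ 2 ≤ Θ * ∑' x, f x ^ 2) :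
    ∃ C ρ : ℝ≥0∞, C ≠ ⊤ ∧ ρ < 1 ∧ ∀ n x y, (q ^ n) x y ≤ C * ρ ^ n := by
  have h1 : ∀ n x, ∑' y, ((q ^ (M * n)) x y) ^ 2 ≤ Θ ^ n := by
    intro n x
    induction n with
    | zero =>
      simp only [mul_zero, pow_zero]
      rw [tsum_eq_single x (fun y hy => by rw [one_ne hy.symm]; simp), one_self]; simp
    | succ n ih =>
      rw [mul_add, mul_one, pow_add]
      refine (h _).trans ?_
      rw [pow_succ, mul_comm]; gcongr
  have h2 : ∀ n x y, ((q ^ (M * n)) x y) ^ 2 ≤ Θ ^ n := fun n x y =>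
    (ENNReal.le_tsum (f := fun y => ((q ^ (M * n)) x y) ^ 2) y).trans (h1 n x)
  set Θ' := max Θ (1 / 2) with hΘ'
  have hΘ'1 : Θ' < 1 := max_lt hΘ (by simp)
  have hΘ'0 : 0 < Θ' := lt_of_lt_of_le (by simp) (le_max_right _ _)
  have hM0 : (0 : ℝ) < M := by exact_mod_cast hM
  set ρ : ℝ≥0∞ := Θ' ^ (1 / (2 * M) : ℝ) with hρ
  have hρ1 : ρ < 1 := ENNReal.rpow_lt_one hΘ'1 (by positivity)
  have hρ0 : ρ ≠ 0 := (ENNReal.rpow_pos hΘ'0 (ne_top_of_lt hΘ'1)).ne'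
  have hρM : ρ ^ (2 * M) = Θ' := by
    rw [hρ, ← ENNReal.rpow_natCast, ← ENNReal.rpow_mul]
    push_cast
    rw [one_div, inv_mul_cancel₀ (by positivity), ENNReal.rpow_one]
  refine ⟨(ρ ^ M)⁻¹, ρ, by simp [hρ0], hρ1, fun k x y => ?_⟩
  have hkd := Nat.div_add_mod k M
  have hr := Nat.mod_lt k (show 0 < M by omega)
  set n := k / M
  set r := k % M
  have hb : ∀ x z, (q ^ (M * n)) x z ≤ ρ ^ (M * n) := by
    intro x z
    apply le_of_sq
    calc _ ≤ Θ ^ n := h2 n x z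
      _ ≤ Θ' ^ n := by gcongr; exact le_max_left _ _
      _ = _ := by rw [← hρM, ← pow_mul, ← pow_mul]; congr 1; ring
  calc (q ^ k) x y = ∑' z, (q ^ (M * n)) x z * (q ^ r) z y := by rw [← hkd, pow_add, mul_apply]
    _ ≤ ∑' z, ρ ^ (M * n) * (q ^ r) z y := by gcongr; exact hb _ _
    _ = ρ ^ (M * n) := by rw [ENNReal.tsum_mul_left, col_pow q hc, mul_one]
    _ = (ρ ^ M)⁻¹ * ρ ^ (M + M * n) := by
      rw [pow_add, ← mul_assoc, ENNReal.inv_mul_cancel (by simp [hρ0]) (ENNReal.pow_ne_top (ne_top_of_lt hρ1)), one_mul]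
    _ ≤ (ρ ^ M)⁻¹ * ρ ^ k := by
      gcongr 1
      exact pow_le_pow_right_of_le_one' hρ1.le (by omega)

lemma pow_lower {S : Set Γ} (hS : IsGenSet S) {q : Ker Γ} {c : ℝ≥0∞} (hc1 : c ≤ 1)
    (hq : ∀ x y, dd S x y ≤ 1 → c ≤ q x y) (n : ℕ) : ∀ x y, dd S x y ≤ n → c ^ n ≤ (q ^ n) x y := by
  induction n with
  | zero =>
    intro x y h
    have : dd S x y = 0 := le_antisymm (by simpa using h) (dd_nonneg S x y)
    rw [dd_eq_zero hS this, pow_zero, pow_zero, one_self]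
  | succ n ih =>
    intro x y h
    obtain ⟨z, h1, h2⟩ : ∃ z, dd S x z ≤ 1 ∧ dd S z y ≤ n := by
      by_cases h0 : dd S x y ≤ 1
      · refine ⟨y, h0, ?_⟩
        rw [dd_self]; positivity
      · obtain ⟨z, h1, h2⟩ := dd_split hS x y 1 (by
          have := not_le.1 h0
          push_cast; exact this.le)
        refine ⟨z, by simp [h1], ?_⟩
        push_cast at h
        rw [h2]; push_cast; linarith
    rw [pow_succ', pow_succ']
    exact (mul_le_mul' (hq _ _ h1) (ih _ _ h2)).trans (mul_apply_ge _ _ _ _ _)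

lemma exists_good {S : Set Γ} {δ : ℝ} (hS : IsGenSet S) (hδ : IsHyperbolic S δ) (hne : Nonelementary Γ)
    (q : Ker Γ) (N : ℕ) (c : ℝ≥0∞) (hc0 : c ≠ 0) (hr : ∀ x, ∑' y, q x y = 1)
    (hc : ∀ y, ∑' x, q x y = 1)
    (hrange : ∀ x y, q x y ≠ 0 → dd S x y ≤ N) (hlow : ∀ x y, dd S x y ≤ 1 → c ≤ q x y) :
    ∃ C ρ, Good S q N c C ρ := by
  have hc1 : c ≤ 1 := by
    rw [← hr 1]
    exact (hlow 1 1 (by rw [dd_self]; norm_num)).trans (ENNReal.le_tsum 1)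
  obtain ⟨M, ε, l, hM, hε, hl0, hl1, hdr⟩ := ball_drift hS hδ hne
  obtain ⟨Θ, hΘ, hcon⟩ := norm_contract (bl hS M) ((mem_bl hS M 1).2 (by simp [wl_one]))
    (fun g hg => by rw [mem_bl] at hg ⊢; rwa [wl_inv hS])
    (q ^ M) (row_pow q hr M) (col_pow q hc M) (c ^ M) (pow_ne_zero _ hc0)
    (fun x y h => pow_lower hS hc1 hlow M x y (by
      rw [mem_bl] at h
      have : dd S x y = wl S (x⁻¹ * y) := rfl
      rw [this]; exact_mod_cast h))
    (fun x => ENNReal.ofReal (Real.exp (-ε * wl S x))) (fun x => by simp [Real.exp_pos])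
    (ENNReal.ofReal l) (by simpa using hl1) (fun x => by
      rw [← ENNReal.ofReal_sum_of_nonneg (fun i _ => (Real.exp_pos _).le), ← ENNReal.ofReal_natCast,
        ← ENNReal.ofReal_mul (by positivity), ← ENNReal.ofReal_mul (by positivity)]
      exact ENNReal.ofReal_le_ofReal (hdr x))
  obtain ⟨C, ρ, h1, h2, h3⟩ := decay_of q hc M hM Θ hΘ hcon
  exact ⟨C, ρ, hrange, hlow, h3, hc0, hc1, h1, h2⟩

/-! ### The kernel of the random walk and its averages -/

/-- averaged kernel -/
noncomputable def avq {X : Type} (P : Ker X) (N : ℕ) : Ker X :=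
  fun x y => (N : ℝ≥0∞)⁻¹ * ∑ j ∈ Finset.range N, (P ^ (j + 1)) x y

/-- remainder kernel -/
noncomputable def avr {X : Type} (P : Ker X) (N : ℕ) : Ker X :=
  fun x y => (N : ℝ≥0∞)⁻¹ * ∑ j ∈ Finset.range N, ∑ k ∈ Finset.range (j + 1), (P ^ k) x y

lemma avq_mul {X : Type} (P W : Ker X) (N : ℕ) (x y : X) :
    (avq P N * W) x y = (N : ℝ≥0∞)⁻¹ * ∑ j ∈ Finset.range N, (P ^ (j + 1) * W) x y := by
  rw [mul_apply]
  simp only [avq, mul_apply, mul_assoc, Finset.sum_mul]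
  rw [ENNReal.tsum_mul_left, Summable.tsum_finsetSum (fun _ _ => ENNReal.summable)]

lemma natinv (N : ℕ) (hN : 1 ≤ N) : (N : ℝ≥0∞)⁻¹ * N = 1 :=
  ENNReal.inv_mul_cancel (by exact_mod_cast (show N ≠ 0 by omega)) (by simp)

lemma av_split {X : Type} (P W : Ker X) (N : ℕ) (x y : X) :
    (avr P N + avq P N * W) x y = (N : ℝ≥0∞)⁻¹ * ∑ j ∈ Finset.range N,
      (∑ k ∈ Finset.range (j + 1), P ^ k + P ^ (j + 1) * W) x y := by
  rw [add_apply, avq_mul, avr, ← mul_add, ← Finset.sum_add_distrib]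
  simp only [add_apply, Ker.sum_apply]

lemma gr_split {X : Type} (P : Ker X) (n : ℕ) :
    gr P = ∑ k ∈ Finset.range n, P ^ k + P ^ n * gr P := by
  induction n with
  | zero => simp
  | succ n ih =>
    rw [Finset.sum_range_succ, pow_succ, mul_assoc, add_assoc]
    have : P ^ n * gr P = P ^ n + P ^ n * (P * gr P) := by
      nth_rw 1 [gr_eq P]; rw [mul_add, mul_one]
    rw [← this]; exact ih

lemma av_gr {X : Type} (P : Ker X) (N : ℕ) (hN : 1 ≤ N) :
    avr P N + avq P N * gr P = gr P := by
  ext x y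
  rw [av_split]
  simp only [← gr_split, Finset.sum_const, Finset.card_range, nsmul_eq_mul]
  rw [← mul_assoc, natinv N hN, one_mul]

lemma av_partial {X : Type} (P : Ker X) (N : ℕ) (hN : 1 ≤ N) (M : ℕ) :
    ∑ k ∈ Finset.range M, P ^ k ≤ avr P N + avq P N * ∑ k ∈ Finset.range M, P ^ k := by
  intro x y
  rw [av_split]
  calc (∑ k ∈ Finset.range M, P ^ k) x y
      = (N : ℝ≥0∞)⁻¹ * ∑ j ∈ Finset.range N, (∑ k ∈ Finset.range M, P ^ k) x y := by
        simp only [Finset.sum_const, Finset.card_range, nsmul_eq_mul]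
        rw [← mul_assoc, natinv N hN, one_mul]
    _ ≤ _ := by
        refine mul_le_mul' le_rfl (Finset.sum_le_sum fun j _ => ?_)
        have : ∑ k ∈ Finset.range (j + 1), P ^ k + P ^ (j + 1) * ∑ k ∈ Finset.range M, P ^ k
            = ∑ k ∈ Finset.range (j + 1 + M), P ^ k := by
          rw [Finset.sum_range_add _ (j + 1) M, Finset.mul_sum]
          congr 1
          exact Finset.sum_congr rfl fun k _ => (pow_add P (j + 1) k).symm
        rw [this, Ker.sum_apply, Ker.sum_apply]
        exact Finset.sum_le_sum_of_subset (Finset.range_mono (by omega))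

lemma gr_eq_av {X : Type} (P : Ker X) (N : ℕ) (hN : 1 ≤ N) (hc : ∀ y, ∑' x, P x y = 1)
    (C ρ : ℝ≥0∞) (hC : C ≠ ⊤) (hρ : ρ < 1) (hd : ∀ n x y, (avq P N ^ n) x y ≤ C * ρ ^ n) :
    gr P = gr (avq P N) * avr P N := by
  set q := avq P N
  set R := avr P N
  refine le_antisymm ?_ (gr_mul_le _ _ _ (av_gr P N hN).le)
  refine gr_le_of _ _ fun M => ?_
  set Y := ∑ k ∈ Finset.range M, P ^ k with hY
  have it : ∀ m : ℕ, Y ≤ (∑ i ∈ Finset.range m, q ^ i) * R + q ^ m * Y := by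
    intro m
    induction m with
    | zero => simp
    | succ m ih =>
      refine ih.trans ?_
      have h1 : q ^ m * Y ≤ q ^ m * (R + q * Y) := mul_le_mul'' le_rfl (av_partial P N hN M)
      refine (add_le_add' le_rfl h1).trans (le_of_eq ?_)
      rw [Finset.sum_range_succ, pow_succ]; noncomm_ring
  intro x y
  have hcol : ∑' z, Y z y = M := by
    simp only [hY, Ker.sum_apply]
    rw [Summable.tsum_finsetSum (fun _ _ => ENNReal.summable)]
    simp [col_pow P hc]
  have hb : ∀ m : ℕ, Y x y ≤ (gr q * R) x y + C * M * ρ ^ m := by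
    intro m
    refine (it m x y).trans ?_
    rw [add_apply]
    refine add_le_add ?_ ?_
    · refine mul_le_mul'' ?_ le_rfl x y
      intro a b
      rw [Ker.sum_apply, gr_apply]; exact ENNReal.sum_le_tsum _
    · rw [mul_apply]
      calc _ ≤ ∑' z, C * ρ ^ m * Y z y := ENNReal.tsum_le_tsum fun z => mul_le_mul' (hd m x z) le_rfl
        _ = _ := by rw [ENNReal.tsum_mul_left, hcol]; ring
  have hlim : Tendsto (fun m : ℕ => (gr q * R) x y + C * M * ρ ^ m) atTop (𝓝 ((gr q * R) x y + 0)) := by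
    refine Tendsto.add tendsto_const_nhds ?_
    have := ENNReal.Tendsto.const_mul (a := C * M) (ENNReal.tendsto_pow_atTop_nhds_zero_of_lt_one hρ)
      (Or.inr (ENNReal.mul_ne_top hC (by simp)))
    simpa using this
  rw [add_zero] at hlim
  exact ge_of_tendsto' hlim hb

/-- kernel of the random walk -/
noncomputable def PK (μ : Γ → ℝ) : Ker Γ := fun x y => ENNReal.ofReal (μ (x⁻¹ * y))

section RW
variable {S : Set Γ} {μ : Γ → ℝ}

lemma mu_sum (hμ : IsRWMeasure S μ) : ∑' g, ENNReal.ofReal (μ g) = 1 := by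
  have hs : Summable μ := by
    by_contra hc
    have := hμ.total
    rw [tsum_eq_zero_of_not_summable hc] at this
    norm_num at this
  rw [← ENNReal.ofReal_tsum_of_nonneg hμ.nonneg hs, hμ.total, ENNReal.ofReal_one]

lemma PK_row (hμ : IsRWMeasure S μ) (x : Γ) : ∑' y, PK μ x y = 1 := by
  rw [← mu_sum hμ, ← (Equiv.mulLeft x).tsum_eq]; simp [PK]

lemma PK_col (hμ : IsRWMeasure S μ) (y : Γ) : ∑' x, PK μ x y = 1 := by
  rw [← mu_sum hμ, ← ((Equiv.inv Γ).trans (Equiv.mulLeft y)).tsum_eq]; simp [PK]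

lemma ptrans_nonneg (hμ : IsRWMeasure S μ) (n : ℕ) (x y : Γ) : 0 ≤ ptrans μ n x y := by
  induction n generalizing y with
  | zero => unfold ptrans; split_ifs <;> norm_num
  | succ n ih => exact tsum_nonneg fun z => mul_nonneg (ih z) (hμ.nonneg _)

lemma PK_pow (hS : IsGenSet S) (hμ : IsRWMeasure S μ) (n : ℕ) (x y : Γ) :
    (PK μ ^ n) x y = ENNReal.ofReal (ptrans μ n x y) := by
  induction n generalizing y with
  | zero =>
    rw [pow_zero, one_apply]; unfold ptrans; split_ifs <;> simp
  | succ n ih =>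
    rw [pow_succ, mul_apply]
    show _ = ENNReal.ofReal (∑' z : Γ, ptrans μ n x z * μ (z⁻¹ * y))
    rw [ENNReal.ofReal_tsum_of_nonneg (fun z => mul_nonneg (ptrans_nonneg hμ n x z) (hμ.nonneg _))]
    · refine tsum_congr fun z => ?_
      rw [ih, ENNReal.ofReal_mul (ptrans_nonneg hμ n x z), PK]
    · apply summable_of_hasFiniteSupport
      refine ((hS.1.image fun s => y * s⁻¹)).subset fun z hz => ?_
      have : μ (z⁻¹ * y) ≠ 0 := right_ne_zero_of_mul hz
      exact ⟨z⁻¹ * y, hμ.support_subset _ this, by group⟩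

lemma green_eq (hS : IsGenSet S) (hμ : IsRWMeasure S μ) (x y : Γ) :
    green μ x y = (gr (PK μ) x y).toReal := by
  rw [gr_apply, ENNReal.tsum_toReal_eq (fun n => by rw [PK_pow hS hμ]; simp)]
  unfold green
  refine tsum_congr fun n => ?_
  rw [PK_pow hS hμ, ENNReal.toReal_ofReal (ptrans_nonneg hμ n x y)]

lemma PK_range (hS : IsGenSet S) (hμ : IsRWMeasure S μ) (n : ℕ) : ∀ x y, (PK μ ^ n) x y ≠ 0 →
    dd S x y ≤ n := by
  induction n with
  | zero =>
    intro x y h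
    have : x = y := by
      by_contra hc
      exact h (by rw [pow_zero, one_ne hc])
    rw [this, dd_self]; positivity
  | succ n ih =>
    intro x y h
    rw [pow_succ, mul_apply] at h
    obtain ⟨z, hz⟩ : ∃ z, (PK μ ^ n) x z * PK μ z y ≠ 0 := by
      by_contra hc
      push Not at hc
      exact h (ENNReal.tsum_eq_zero.2 hc)
    have h1 := ih x z (left_ne_zero_of_mul hz)
    have h2 : μ (z⁻¹ * y) ≠ 0 := by
      intro h0
      exact right_ne_zero_of_mul hz (by simp [PK, h0])
    have h3 : wl S (z⁻¹ * y) ≤ 1 := by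
      have := wl_le_of_list S [z⁻¹ * y] (by simpa using hμ.support_subset _ h2)
      simpa using this
    have h4 : dd S z y ≤ 1 := by
      have : dd S z y = wl S (z⁻¹ * y) := rfl
      rw [this]; exact_mod_cast h3
    have := dd_tri hS x z y
    push_cast; linarith

lemma PK_inv (μ : Γ → ℝ) (n : ℕ) (g : Γ) : ∀ x y, (PK μ ^ n) (g * x) (g * y) = (PK μ ^ n) x y := by
  induction n with
  | zero =>
    intro x y
    by_cases h : x = y
    · rw [h, pow_zero, one_self, one_self]
    · rw [pow_zero, one_ne h, one_ne (fun h' => h (mul_left_cancel h'))]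
  | succ n ih =>
    intro x y
    rw [pow_succ, mul_apply, mul_apply, ← (Equiv.mulLeft g).tsum_eq]
    refine tsum_congr fun z => ?_
    simp only [Equiv.coe_mulLeft, ih]
    congr 1
    simp [PK, mul_assoc]

lemma PK_list (l : List Γ) (hl : ∀ x ∈ l, 0 < μ x) : ∀ x, (PK μ ^ l.length) x (x * l.prod) ≠ 0 := by
  induction l with
  | nil => intro x; simp [one_self]
  | cons a l ih =>
    intro x
    have h1 : PK μ x (x * a) ≠ 0 := by
      have := hl a (by simp)
      simp [PK, this]
    have h2 := ih (fun z hz => hl z (by simp [hz])) (x * a)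
    rw [List.length_cons, pow_succ', List.prod_cons, ← mul_assoc]
    exact ne_of_gt (lt_of_lt_of_le (pos_iff_ne_zero.2 (mul_ne_zero h1 h2)) (mul_apply_ge _ _ _ _ _))

lemma PK_reach (hμ : IsRWMeasure S μ) (g : Γ) : ∃ k : ℕ, ∀ x, (PK μ ^ (k + 1)) x (x * g) ≠ 0 := by
  obtain ⟨l, hl, hl2, rfl⟩ := hμ.nondeg g
  refine ⟨l.length - 1, fun x => ?_⟩
  have : l.length - 1 + 1 = l.length := Nat.sub_add_cancel (List.length_pos_iff.2 hl)
  rw [this]; exact PK_list l hl2 x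

theorem exists_avg {δ : ℝ} (hS : IsGenSet S) (hδ : IsHyperbolic S δ) (hne : Nonelementary Γ)
    (hμ : IsRWMeasure S μ) :
    ∃ (q R : Ker Γ) (N : ℕ) (c C ρ : ℝ≥0∞), Good S q N c C ρ ∧
      (∀ z y, R z y ≠ 0 → dd S z y ≤ N) ∧ gr (PK μ) = gr q * R ∧
      ∀ x y, gr (PK μ) x y ≠ 0 ∧ gr (PK μ) x y ≠ ⊤ := by
  choose k hk using PK_reach hμ
  set N : ℕ := (bl hS 1).sup k + 1 with hN
  have hN1 : 1 ≤ N := by omega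
  have hNi : (N : ℝ≥0∞)⁻¹ ≠ 0 := by simp
  have hqi : ∀ x y, avq (PK μ) N x y = avq (PK μ) N 1 (x⁻¹ * y) := by
    intro x y
    simp only [avq]
    congr 1
    refine Finset.sum_congr rfl fun j _ => ?_
    rw [← PK_inv μ (j + 1) x 1 (x⁻¹ * y)]; simp
  obtain ⟨g0, hg0, hmin⟩ := Finset.exists_min_image (bl hS 1) (fun g => avq (PK μ) N 1 g)
    ⟨1, (mem_bl hS 1 1).2 (by simp [wl_one])⟩
  have hpos : avq (PK μ) N 1 g0 ≠ 0 := by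
    refine mul_ne_zero hNi (ne_of_gt ?_)
    have h1 : k g0 ∈ Finset.range N := by
      rw [Finset.mem_range, hN]
      exact Nat.lt_succ_of_le (Finset.le_sup (f := k) hg0)
    refine lt_of_lt_of_le (pos_iff_ne_zero.2 ?_)
      (Finset.single_le_sum (f := fun j => (PK μ ^ (j + 1)) 1 g0) (fun _ _ => bot_le) h1)
    have := hk g0 1
    rwa [one_mul] at this
  have hrow : ∀ x, ∑' y, avq (PK μ) N x y = 1 := by
    intro x
    simp only [avq]
    rw [ENNReal.tsum_mul_left, Summable.tsum_finsetSum (fun _ _ => ENNReal.summable)]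
    simp only [row_pow _ (PK_row hμ), Finset.sum_const, Finset.card_range, nsmul_eq_mul, mul_one]
    exact natinv N hN1
  have hcol : ∀ y, ∑' x, avq (PK μ) N x y = 1 := by
    intro x
    simp only [avq]
    rw [ENNReal.tsum_mul_left, Summable.tsum_finsetSum (fun _ _ => ENNReal.summable)]
    simp only [col_pow _ (PK_col hμ), Finset.sum_const, Finset.card_range, nsmul_eq_mul, mul_one]
    exact natinv N hN1
  have hrange : ∀ x y, avq (PK μ) N x y ≠ 0 → dd S x y ≤ N := by
    intro x y h
    obtain ⟨j, hj, h2⟩ := Finset.exists_ne_zero_of_sum_ne_zero (right_ne_zero_of_mul h)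
    refine (PK_range hS hμ _ x y h2).trans ?_
    have := Finset.mem_range.1 hj
    exact_mod_cast this
  have hrange2 : ∀ x y, avr (PK μ) N x y ≠ 0 → dd S x y ≤ N := by
    intro x y h
    obtain ⟨j, hj, h2⟩ := Finset.exists_ne_zero_of_sum_ne_zero (right_ne_zero_of_mul h)
    obtain ⟨i, hi, h3⟩ := Finset.exists_ne_zero_of_sum_ne_zero h2
    refine (PK_range hS hμ _ x y h3).trans ?_
    have := Finset.mem_range.1 hj
    have := Finset.mem_range.1 hi
    exact_mod_cast (show i ≤ N by omega)
  obtain ⟨C, ρ, hg⟩ := exists_good hS hδ hne (avq (PK μ) N) N _ hpos hrow hcol hrange (by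
    intro x y h
    rw [hqi x y]
    refine hmin _ ((mem_bl hS 1 _).2 ?_)
    have h' : (wl S (x⁻¹ * y) : ℝ) ≤ 1 := h
    exact_mod_cast h')
  have heq := gr_eq_av (PK μ) N hN1 (PK_col hμ) C ρ hg.C1 hg.ρ1 hg.decay
  refine ⟨_, _, N, _, C, ρ, hg, hrange2, heq, fun x y => ⟨?_, ?_⟩⟩
  · have := hk (x⁻¹ * y) x
    rw [mul_inv_cancel_left] at this
    exact ne_of_gt (lt_of_lt_of_le (pos_iff_ne_zero.2 this) (pow_le_gr _ _ _ _))
  · obtain ⟨A, hA, _, hA2⟩ := gr_bound hg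
    rw [heq, mul_apply]
    have hcolR : ∑' z, avr (PK μ) N z y ≠ ⊤ := by
      simp only [avr]
      rw [ENNReal.tsum_mul_left, Summable.tsum_finsetSum (fun _ _ => ENNReal.summable)]
      refine ENNReal.mul_ne_top (by simp) ?_
      refine (ENNReal.sum_ne_top).2 fun j _ => ?_
      rw [Summable.tsum_finsetSum (fun _ _ => ENNReal.summable)]
      refine (ENNReal.sum_ne_top).2 fun i _ => ?_
      rw [col_pow _ (PK_col hμ)]; simp
    refine ne_top_of_le_ne_top (ENNReal.mul_ne_top hA hcolR) ?_
    rw [← ENNReal.tsum_mul_left]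
    refine ENNReal.tsum_le_tsum fun z => mul_le_mul' ?_ le_rfl
    have := hA2 Set.univ x z
    rwa [rs_univ] at this
end RW

/-! ### Conclusion -/

lemma rep_of {q R G : Ker Γ} (hG : G = gr q * R) (y : Γ) (D : Set Γ)
    (hD : ∀ z, R z y ≠ 0 → z ∉ D) : Rep q (fun x => G x y) D := by
  intro x hx
  have hx' : x ∉ Dᶜ := fun h => h hx
  simp only [hG, mul_apply]
  simp only [← ENNReal.tsum_mul_left]
  rw [ENNReal.tsum_comm]
  refine tsum_congr fun z => ?_
  by_cases hz : R z y = 0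
  · simp [hz]
  have hzD := hD z hz
  have hxz : x ≠ z := by rintro rfl; exact hzD hx
  rw [gr_ent Dᶜ q hx' z, compl_compl, gr_rs_right q hzD, one_ne hxz, zero_add,
    ← ENNReal.tsum_mul_right]
  exact tsum_congr fun a => by rw [mul_assoc]

theorem main_est {S : Set Γ} {μ : Γ → ℝ} {δ : ℝ} (hS : IsGenSet S) (hδ : IsHyperbolic S δ)
    (hne : Nonelementary Γ) (hμ : IsRWMeasure S μ) :
    ∃ (L N : ℕ) (θ H : ℝ), 0 < L ∧ 0 ≤ θ ∧ θ < 1 ∧ 0 ≤ H ∧ (∀ x y, 0 < green μ x y) ∧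
      ∀ (g y y' : Γ) (n : ℕ), (wl S g : ℝ) + (n + 1) * L + N < gp S 1 y y' →
      |martinK μ g y / martinK μ g y' - 1| ≤ H * θ ^ n := by
  obtain ⟨q, R, N, c, C, ρ, hg, hR, hG, hfin⟩ := exists_avg hS hδ hne hμ
  obtain ⟨L, θ, H, hL, hθ, hH, hcon⟩ := contraction hS hδ hg
  have hθt : θ ≠ ⊤ := ne_top_of_lt hθ
  have hpos : ∀ x y, 0 < green μ x y := fun x y => by
    rw [green_eq hS hμ]; exact ENNReal.toReal_pos (hfin x y).1 (hfin x y).2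
  refine ⟨L, N, θ.toReal, H.toReal, hL, ENNReal.toReal_nonneg, ?_, ENNReal.toReal_nonneg, hpos, ?_⟩
  · rw [← ENNReal.toReal_one]; exact (ENNReal.toReal_lt_toReal hθt (by simp)).2 hθ
  intro g y y' n hgp
  have hN0 : (0 : ℝ) ≤ N := by positivity
  have hyy : gp S 1 y y' ≤ wl S y := by
    have := gp_le_left hS 1 y y'
    rwa [dd_one' hS] at this
  have hlevel : ∀ w z, gp S 1 y y' ≤ gp S 1 w y → dd S z w ≤ N →
      ∀ D, D ⊆ lev S y (((wl S g : ℕ) : ℝ) + (n + 1) * L) → z ∉ D := by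
    intro w z h1 h2 D hD hz
    have h3 : gp S 1 z y ≤ (wl S g : ℝ) + (n + 1) * L := hD hz
    have h4 := gp_lip hS y w z
    linarith
  obtain ⟨m, hm0, hmt, hm⟩ := hcon y (wl S g) n (fun x => gr (PK μ) x y) (fun x => gr (PK μ) x y')
    (by
      have : (wl S g : ℝ) + (n + 1) * L ≤ wl S y := by linarith
      exact_mod_cast this)
    (fun x => hfin x y) (fun x => hfin x y') (fun D hD => ⟨
      rep_of hG y D (fun z hz => hlevel y z (by rw [gp_self_eq, dd_one' hS]; exact hyy) (hR z y hz) D hD),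
      rep_of hG y' D (fun z hz => hlevel y' z (by rw [gp_comm hS]) (hR z y' hz) D hD)⟩)
  have hreal : ∀ x ∈ lev S y (wl S g), m.toReal * green μ x y' ≤ green μ x y ∧
      green μ x y ≤ m.toReal * (1 + H.toReal * θ.toReal ^ n) * green μ x y' := by
    intro x hx
    obtain ⟨h1, h2⟩ := hm x hx
    have e : (H * θ ^ n) ≠ ⊤ := ENNReal.mul_ne_top hH (ENNReal.pow_ne_top hθt)
    have e2 : (1 + H * θ ^ n) ≠ ⊤ := ENNReal.add_ne_top.2 ⟨by simp, e⟩
    have h1' := ENNReal.toReal_mono (hfin x y).2 h1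
    have h2' := ENNReal.toReal_mono (ENNReal.mul_ne_top (ENNReal.mul_ne_top hmt e2) (hfin x y').2) h2
    rw [ENNReal.toReal_mul] at h1'
    rw [ENNReal.toReal_mul, ENNReal.toReal_mul, ENNReal.toReal_add (by simp) e, ENNReal.toReal_mul,
      ENNReal.toReal_pow, ENNReal.toReal_one] at h2'
    rw [green_eq hS hμ, green_eq hS hμ]
    exact ⟨h1', h2'⟩
  obtain ⟨a1, a2⟩ := hreal g (by
    have := gp_le_left hS 1 g y
    rw [dd_one' hS] at this
    exact this)
  obtain ⟨b1, b2⟩ := hreal 1 (one_mem_lev hS y (by positivity))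
  have he : 0 ≤ H.toReal * θ.toReal ^ n := by positivity
  have hmp : 0 < m.toReal := ENNReal.toReal_pos hm0 hmt
  revert a1 a2 b1 b2 he hmp
  unfold martinK
  have p1 := hpos g y
  have p2 := hpos g y'
  have p3 := hpos 1 y
  have p4 := hpos 1 y'
  revert p1 p2 p3 p4
  generalize green μ g y = A
  generalize green μ g y' = B
  generalize green μ 1 y = C'
  generalize green μ 1 y' = D'
  generalize H.toReal * θ.toReal ^ n = e
  generalize m.toReal = m
  intro p1 p2 p3 p4 a1 a2 b1 b2 he hmp
  have u1 : A * D' ≤ (1 + e) * (C' * B) := by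
    calc A * D' ≤ (m * (1 + e) * B) * D' := by gcongr
      _ = (1 + e) * ((m * D') * B) := by ring
      _ ≤ _ := by gcongr
  have u2 : C' * B ≤ (1 + e) * (A * D') := by
    calc C' * B ≤ (m * (1 + e) * D') * B := by gcongr
      _ = (1 + e) * ((m * B) * D') := by ring
      _ ≤ _ := by gcongr
  have e1 : A / C' / (B / D') = (A * D') / (C' * B) := by field_simp
  have pCB : 0 < C' * B := by positivity
  have pAD : 0 < A * D' := by positivity
  rw [e1, abs_le]
  constructor
  · rw [neg_le_sub_iff_le_add, ← sub_le_iff_le_add, le_div_iff₀ pCB]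
    by_cases h1 : e ≤ 1
    · calc (1 - e) * (C' * B) ≤ (1 - e) * ((1 + e) * (A * D')) := by
            gcongr
        _ = (1 - e ^ 2) * (A * D') := by ring
        _ ≤ 1 * (A * D') := by gcongr; nlinarith
        _ = _ := one_mul _
    · nlinarith
  · rw [sub_le_iff_le_add, div_le_iff₀ pCB]
    linarith

lemma martin_lower {S : Set Γ} {μ : Γ → ℝ} (hS : IsGenSet S) (hμ : IsRWMeasure S μ)
    (hpos : ∀ x y, 0 < green μ x y) (g : Γ) : ∃ κ : ℝ, 0 < κ ∧ ∀ y, κ ≤ martinK μ g y := by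
  obtain ⟨k, hk⟩ := PK_reach hμ g⁻¹
  have hk1 := hk g
  rw [mul_inv_cancel] at hk1
  have hkt : (PK μ ^ (k + 1)) g 1 ≠ ⊤ := by rw [PK_pow hS hμ]; simp
  refine ⟨((PK μ ^ (k + 1)) g 1).toReal, ENNReal.toReal_pos hk1 hkt, fun y => ?_⟩
  have hgt : gr (PK μ) g y ≠ ⊤ := by
    intro h
    have := hpos g y
    rw [green_eq hS hμ, h] at this
    simp at this
  have h1 : (PK μ ^ (k + 1)) g 1 * gr (PK μ) 1 y ≤ gr (PK μ) g y := by
    refine (mul_apply_ge _ _ _ _ _).trans ?_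
    conv_rhs => rw [gr_split (PK μ) (k + 1), add_apply]
    exact le_add_self
  have h2 := ENNReal.toReal_mono hgt h1
  rw [ENNReal.toReal_mul, ← green_eq hS hμ, ← green_eq hS hμ] at h2
  unfold martinK
  rwa [le_div_iff₀ (hpos 1 y)]

lemma exists_seqs {S : Set Γ} (B : Boundary Γ S) (ξ η : B.pt) (h : 1 ≤ bgpR B ξ η) :
    ∃ u v : ℕ → Γ, (ConvInf S u ∧ B.cls u = ξ) ∧ (ConvInf S v ∧ B.cls v = η) ∧
      ∀ᶠ n in atTop, bgpR B ξ η - 1 < gp S 1 (u n) (v n) := by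
  have ht : bgp B ξ η ≠ ⊤ := by
    intro hc
    rw [bgpR, hc] at h
    norm_num at h
  have h1 : ENNReal.ofReal (bgpR B ξ η - 1) < bgp B ξ η := by
    rw [ENNReal.ofReal_lt_iff_lt_toReal (by linarith) ht]
    show bgpR B ξ η - 1 < bgpR B ξ η
    linarith
  rw [bgp, lt_iSup_iff] at h1
  obtain ⟨u, h1⟩ := h1
  rw [lt_iSup_iff] at h1
  obtain ⟨v, h1⟩ := h1
  have h2 := eventually_lt_of_lt_liminf h1
  refine ⟨u.1, v.1, u.2, v.2, ?_⟩
  have hd : Tendsto (fun n : ℕ => (n, n)) atTop atTop := by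
    rw [← prod_atTop_atTop_eq]
    exact tendsto_id.prodMk tendsto_id
  filter_upwards [hd.eventually h2] with n hn
  exact (ENNReal.ofReal_lt_ofReal_iff_of_nonneg (by linarith)).1 hn

theorem martin_kernel_ratio_holder
    (Γ : Type) [Group Γ] (S : Set Γ) (δ : ℝ)
    (hS : IsGenSet S) (hδ : IsHyperbolic S δ) (hne : Nonelementary Γ)
    (μ : Γ → ℝ) (hμ : IsRWMeasure S μ)
    (B : Boundary Γ S)
    (Kb : Γ → B.pt → ℝ)
    (hKb : ∀ (x : Γ) (ξ : B.pt) (u : ℕ → Γ), ConvInf S u → B.cls u = ξ →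
      Tendsto (fun n => martinK μ x (u n)) atTop (𝓝 (Kb x ξ))) :
    ∃ H : ℝ, 0 ≤ H ∧ ∃ L0 : ℝ, 0 < L0 ∧ ∃ τ : ℝ, 0 ≤ τ ∧ τ < 1 ∧
      ∀ (g : Γ) (ξ η : B.pt), L0 ≤ bgpR B ξ η - (wl S g : ℝ) →
        |Kb g ξ / Kb g η - 1| ≤ H * τ ^ (bgpR B ξ η - (wl S g : ℝ)) := by
  -- PROOF
  obtain ⟨L, N, θ, H, hL, hθ0, hθ1, hH, hpos, hmain⟩ := main_est hS hδ hne hμ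
  have hL' : (0 : ℝ) < L := by exact_mod_cast hL
  set θ' : ℝ := max θ (1 / 2) with hθ'
  have t0 : 0 < θ' := lt_of_lt_of_le (by norm_num) (le_max_right _ _)
  have t1 : θ' < 1 := max_lt hθ1 (by norm_num)
  refine ⟨H * θ' ^ (-((N : ℝ) + 1) / L - 2), by positivity, (N : ℝ) + 1 + L, by positivity,
    θ' ^ (1 / L : ℝ), by positivity, Real.rpow_lt_one t0.le t1 (by positivity), ?_⟩
  intro g ξ η hs
  set s : ℝ := bgpR B ξ η - (wl S g : ℝ) with hsdef
  have hwl : (0 : ℝ) ≤ wl S g := by positivity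
  have hN0 : (0 : ℝ) ≤ N := by positivity
  obtain ⟨u, v, hu, hv, huv⟩ := exists_seqs B ξ η (by linarith)
  have hx1 : 1 ≤ (s - N - 1) / L := by rw [le_div_iff₀ hL']; linarith
  obtain ⟨n, hn⟩ : ∃ n : ℕ, ⌊(s - N - 1) / L⌋₊ = n + 1 := by
    have : 1 ≤ ⌊(s - N - 1) / L⌋₊ := Nat.le_floor (by exact_mod_cast hx1)
    exact ⟨⌊(s - N - 1) / L⌋₊ - 1, by omega⟩
  have hn1 : ((n : ℝ) + 1) * L ≤ s - N - 1 := by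
    have := Nat.floor_le (show 0 ≤ (s - N - 1) / L by linarith)
    rw [hn, le_div_iff₀ hL'] at this
    exact_mod_cast this
  have hn2 : (s - N - 1) / L - 2 ≤ n := by
    have := Nat.lt_floor_add_one ((s - N - 1) / L)
    rw [hn] at this
    push_cast at this
    linarith
  have hbound : H * θ ^ n ≤ H * θ' ^ (-((N : ℝ) + 1) / L - 2) * (θ' ^ (1 / L : ℝ)) ^ s := by
    rw [mul_assoc, ← Real.rpow_mul t0.le, ← Real.rpow_add t0]
    gcongr
    calc θ ^ n ≤ θ' ^ n := by gcongr; exact le_max_left _ _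
      _ = θ' ^ (n : ℝ) := (Real.rpow_natCast _ _).symm
      _ ≤ θ' ^ (-((N : ℝ) + 1) / L - 2 + 1 / L * s) := by
        apply Real.rpow_le_rpow_of_exponent_ge t0 t1.le
        refine le_trans (le_of_eq ?_) hn2
        field_simp; ring
  obtain ⟨κ, hκ0, hκ⟩ := martin_lower hS hμ hpos g
  have l1 := hKb g ξ u hu.1 hu.2
  have l2 := hKb g η v hv.1 hv.2
  have hη : κ ≤ Kb g η := ge_of_tendsto' l2 (fun n => hκ _)
  have l3 : Tendsto (fun n => |martinK μ g (u n) / martinK μ g (v n) - 1|) atTop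
      (𝓝 |Kb g ξ / Kb g η - 1|) := ((l1.div l2 (by linarith)).sub_const 1).abs
  refine le_trans (le_of_tendsto l3 ?_) hbound
  filter_upwards [huv] with i hi
  exact hmain g (u i) (v i) n (by linarith)

end HarmonicBoundary
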